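/- Let N(X) denote the number of SL₂(ℤ)-equivalence classes of matrices T ∈ P(ℤ) with det T ≤ X (equivalently, the number of reduced matrices T ∈ P(ℤ) with det T ≤ X). Then there are constants C > 0 and X₀ such that |N(X) − (4π/9)·X^{3/2} + X| ≤ C·X^{3/4} for all X ≥ X₀. -/

import Mathlib

/-- A reduced matrix `T = (a, b; b, c) ∈ P(ℤ)` is encoded by the integer triple
`(a, b2, c)` with `b2 = 2b`: it is positive definite (`0 < a` and `0 < det T`,
i.e. `b2² < 4ac`), weakly reduced (`2|b| ≤ a ≤ c`), and `b ≥ 0` whenever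
`2|b| = a` or `a = c`. -/
def IsReducedTriple (a b2 c : ℤ) : Prop :=
  0 < a ∧ b2^2 < 4*a*c ∧ |b2| ≤ a ∧ a ≤ c ∧ ((|b2| = a ∨ a = c) → 0 ≤ b2)

/-- The determinant `ac - b² = ac - b2²/4` of the encoded matrix. -/
noncomputable def detTriple (a b2 c : ℤ) : ℝ := (a:ℝ) * (c:ℝ) - (b2:ℝ)^2/4

/-- `N(X)`: the number of reduced matrices in `P(ℤ)` of determinant at most `X`. -/
noncomputable def Ncount (X : ℝ) : ℕ :=
  Set.ncard {p : ℤ × ℤ × ℤ | IsReducedTriple p.1 p.2.1 p.2.2 ∧ detTriple p.1 p.2.1 p.2.2 ≤ X}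

open Finset

/-- The additive character `e(x) = exp(2πix)`. -/
noncomputable def ee (x : ℝ) : ℂ := Complex.exp ((2 * Real.pi * x : ℝ) * Complex.I)

lemma ee_norm (x : ℝ) : ‖ee x‖ = 1 := by
  unfold ee; exact Complex.norm_exp_ofReal_mul_I _

lemma ee_add (x y : ℝ) : ee (x + y) = ee x * ee y := by
  unfold ee; rw [← Complex.exp_add]; congr 1; push_cast; ring

lemma ee_zero : ee 0 = 1 := by simp [ee]

lemma ee_int (n : ℤ) : ee n = 1 := by
  unfold ee
  rw [Complex.exp_eq_one_iff]
  exact ⟨n, by push_cast; ring⟩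

lemma ee_nat (n : ℕ) : ee n = 1 := by
  have := ee_int n
  simpa using this

lemma ee_add_int (x : ℝ) (n : ℤ) : ee (x + n) = ee x := by
  rw [ee_add, ee_int, mul_one]

lemma ee_sub_int (x : ℝ) (n : ℤ) : ee (x - n) = ee x := by
  have := ee_add_int (x - n) n
  simpa using this.symm

lemma ee_continuous : Continuous ee := by
  unfold ee; fun_prop

lemma ee_sub_one_norm (x : ℝ) : ‖ee x - 1‖ = 2 * |Real.sin (Real.pi * x)| := by
  unfold ee
  have := Complex.norm_exp_I_mul_ofReal_sub_one (2 * Real.pi * x)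
  rw [mul_comm Complex.I] at this
  rw [this, norm_mul]
  simp only [Real.norm_eq_abs, abs_two]
  congr 3; ring

lemma ee_sub_norm (x y : ℝ) : ‖ee x - ee y‖ ≤ 2 * Real.pi * |x - y| := by
  have h : ee x - ee y = ee y * (ee (x - y) - 1) := by
    rw [mul_sub, ← ee_add, mul_one]; congr 2; ring
  rw [h, norm_mul, ee_norm, one_mul, ee_sub_one_norm]
  have := Real.abs_sin_le_abs (x := Real.pi * (x - y))
  rw [abs_mul, abs_of_pos Real.pi_pos] at this
  nlinarith

lemma sin_pi_lower (x : ℝ) (h0 : 0 ≤ x) (h1 : x ≤ 1/2) : 2 * x ≤ Real.sin (Real.pi * x) := by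
  have := Real.mul_le_sin (x := Real.pi * x) (by positivity) (by nlinarith [Real.pi_pos])
  have e : 2 / Real.pi * (Real.pi * x) = 2 * x := by field_simp
  linarith

lemma sin_pi_lower2 (x d : ℝ) (hd : 0 ≤ d) (h0 : d ≤ x) (h1 : x ≤ 1 - d) :
    2 * d ≤ Real.sin (Real.pi * x) := by
  rcases le_total x (1/2) with h | h
  · linarith [sin_pi_lower x (by linarith) h]
  · have := sin_pi_lower (1 - x) (by linarith) (by linarith)
    rw [show Real.pi * (1 - x) = Real.pi - Real.pi * x by ring, Real.sin_pi_sub] at this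
    linarith

lemma abel_id (z w : ℕ → ℂ) (N : ℕ) :
    ∑ k ∈ range (N + 1), (z (k + 1) - z k) * w k
      = z (N + 1) * w N - z 0 * w 0 - ∑ k ∈ range N, z (k + 1) * (w (k + 1) - w k) := by
  induction N with
  | zero => simp; ring
  | succ n ih => rw [sum_range_succ, ih, sum_range_succ _ n]; ring

lemma abel_bound (z w : ℕ → ℂ) (N : ℕ) (hz : ∀ k, ‖z k‖ ≤ 1) :
    ‖∑ k ∈ range (N + 1), (z (k + 1) - z k) * w k‖
      ≤ ‖w N‖ + ‖w 0‖ + ∑ k ∈ range N, ‖w (k + 1) - w k‖ := by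
  rw [abel_id]
  have h1 : ‖z (N + 1) * w N‖ ≤ ‖w N‖ := by
    rw [norm_mul]; exact mul_le_of_le_one_left (norm_nonneg _) (hz _)
  have h2 : ‖z 0 * w 0‖ ≤ ‖w 0‖ := by
    rw [norm_mul]; exact mul_le_of_le_one_left (norm_nonneg _) (hz _)
  have h3 : ‖∑ k ∈ range N, z (k + 1) * (w (k + 1) - w k)‖ ≤ ∑ k ∈ range N, ‖w (k + 1) - w k‖ := by
    refine (norm_sum_le _ _).trans (sum_le_sum fun k _ => ?_)
    rw [norm_mul]; exact mul_le_of_le_one_left (norm_nonneg _) (hz _)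
  calc _ ≤ ‖z (N + 1) * w N - z 0 * w 0‖ + _ := norm_sub_le _ _
    _ ≤ _ := by
      have := norm_sub_le (z (N + 1) * w N) (z 0 * w 0)
      linarith

/-- Kuzmin–Landau, discrete form. -/
lemma kuzmin_landau (f : ℕ → ℝ) (N : ℕ) (j : ℤ) (δ : ℝ) (hδ : 0 < δ)
    (hmono : ∀ k, k + 1 < N → f (k + 1) - f k ≤ f (k + 2) - f (k + 1))
    (hlo : ∀ k, k < N → j + δ ≤ f (k + 1) - f k)
    (hhi : ∀ k, k < N → f (k + 1) - f k ≤ j + 1 - δ) :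
    ‖∑ k ∈ range N, ee (f k)‖ ≤ 1 / δ := by
  rcases N with _ | N
  · simp; positivity
  set c : ℕ → ℝ := fun k => Real.cos (Real.pi * (f (k+1) - f k - j)) / Real.sin (Real.pi * (f (k+1) - f k - j)) with hc
  set w : ℕ → ℂ := fun k => -1/2 - Complex.I / 2 * (c k : ℂ) with hw
  have hs : ∀ k, k < N + 1 → 2 * δ ≤ Real.sin (Real.pi * (f (k+1) - f k - j)) := fun k hk =>
    sin_pi_lower2 _ _ hδ.le (by linarith [hlo k hk]) (by linarith [hhi k hk])
  have hcb : ∀ k, k < N + 1 → |c k| ≤ 1 / (2 * δ) := by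
    intro k hk
    have := hs k hk
    have hpos : 0 < Real.sin (Real.pi * (f (k+1) - f k - j)) := by linarith
    simp only [hc]
    rw [abs_div, abs_of_pos hpos]
    exact div_le_div₀ zero_le_one (Real.abs_cos_le_one _) (by positivity) this
  have key : ∀ k, k < N + 1 → ee (f k) = (ee (f (k+1)) - ee (f k)) * w k := by
    intro k hk
    have hpos : 0 < Real.sin (Real.pi * (f (k+1) - f k - j)) := by linarith [hs k hk]
    have h1 : ee (f (k+1)) = ee (f k) * ee (f (k+1) - f k - j) := by
      rw [ee_sub_int, ← ee_add]; congr 1; ring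
    rw [h1]
    have h2 : (ee (f (k+1) - f k - j) - 1) * w k = 1 := by
      simp only [hw, hc]
      set φ := Real.pi * (f (k+1) - f k - j) with hφ
      have h3 : ee (f (k+1) - f k - j) = (Complex.cos φ + Complex.sin φ * Complex.I)^2 := by
        unfold ee
        rw [← Complex.exp_mul_I, ← Complex.exp_nat_mul]
        congr 1; rw [hφ]; push_cast; ring
      rw [h3]
      push_cast
      have hne : Complex.sin (φ:ℂ) ≠ 0 := by
        rw [← Complex.ofReal_sin]; exact_mod_cast hpos.ne'
      have hsq := Complex.sin_sq_add_cos_sq (φ:ℂ)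
      have hI : Complex.I ^ 2 = -1 := Complex.I_sq
      field_simp
      generalize Complex.sin (φ:ℂ) = s at *
      generalize Complex.cos (φ:ℂ) = t at *
      grind
    linear_combination (- ee (f k)) * h2
  have hcm : ∀ k, k < N → c (k+1) ≤ c k := by
    intro k hk
    have p1 := hs k (by omega)
    have p2 := hs (k+1) (by omega)
    simp only [hc]
    have hm := hmono k (by omega)
    rw [div_le_div_iff₀ (by linarith) (by linarith)]
    have h5 : 0 ≤ Real.sin (Real.pi * (f (k+1+1) - f (k+1) - j) - Real.pi * (f (k+1) - f k - j)) := by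
      have l1 := hlo k (by omega)
      have l2 := hhi (k+1) (by omega)
      apply Real.sin_nonneg_of_nonneg_of_le_pi
      · rw [← mul_sub]
        exact mul_nonneg Real.pi_pos.le (by linarith)
      · rw [← mul_sub]
        have : (f (k + 1 + 1) - f (k + 1) - ↑j - (f (k + 1) - f k - ↑j)) ≤ 1 := by linarith
        nlinarith [Real.pi_pos]
    rw [Real.sin_sub] at h5
    linarith
  have hb : ‖∑ k ∈ range (N+1), ee (f k)‖ ≤ ‖w N‖ + ‖w 0‖ + ∑ k ∈ range N, ‖w (k + 1) - w k‖ := by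
    rw [sum_congr rfl fun k hk => key k (mem_range.1 hk)]
    exact abel_bound (fun k => ee (f k)) w N (fun k => (ee_norm _).le)
  have hvar : ∑ k ∈ range N, ‖w (k + 1) - w k‖ ≤ 1 / (2 * δ) := by
    have : ∀ k ∈ range N, ‖w (k + 1) - w k‖ = (c k - c (k+1)) / 2 := by
      intro k hk
      have h6 : w (k+1) - w k = Complex.I * (((c k - c (k+1)) / 2 : ℝ) : ℂ) := by
        simp only [hw]; push_cast; ring
      rw [h6, norm_mul, Complex.norm_I, one_mul, Complex.norm_real, Real.norm_eq_abs, abs_of_nonneg]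
      linarith [hcm k (mem_range.1 hk)]
    rw [sum_congr rfl this, ← sum_div, sum_range_sub']
    have a1 := abs_le.1 (hcb 0 (by omega))
    have a2 := abs_le.1 (hcb N (by omega))
    linarith
  have hwn : ∀ k, k < N + 1 → ‖w k‖ ≤ 1 / (4 * δ) := by
    intro k hk
    have h1 := congrArg norm (key k hk)
    rw [norm_mul, ee_norm] at h1
    have h2 : ee (f (k+1)) - ee (f k) = ee (f k) * (ee (f (k+1) - f k - j) - 1) := by
      rw [ee_sub_int, mul_sub, ← ee_add, mul_one]; congr 2; ring
    rw [h2, norm_mul, ee_norm, one_mul, ee_sub_one_norm, abs_of_pos (by linarith [hs k hk])] at h1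
    rw [le_div_iff₀ (by positivity)]
    nlinarith [hs k hk, norm_nonneg (w k)]
  have e1 : 1 / (4*δ) + 1/(4*δ) + 1/(2*δ) = 1/δ := by field_simp; norm_num
  linarith [hwn N (by omega), hwn 0 (by omega)]

lemma ordconv_eq_Ico (S : Finset ℕ) (h : ∀ x ∈ S, ∀ y ∈ S, ∀ z, x ≤ z → z ≤ y → z ∈ S) :
    ∃ p q, p ≤ q ∧ S = Ico p q := by
  rcases S.eq_empty_or_nonempty with rfl | hne
  · exact ⟨0, 0, le_rfl, by simp⟩
  · refine ⟨S.min' hne, S.max' hne + 1, ?_, ?_⟩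
    · have := S.min'_le _ (S.max'_mem hne); omega
    · ext z
      rw [mem_Ico]
      constructor
      · intro hz; exact ⟨S.min'_le _ hz, Nat.lt_succ_of_le (S.le_max' _ hz)⟩
      · rintro ⟨h1, h2⟩
        exact h _ (S.min'_mem hne) _ (S.max'_mem hne) z h1 (by omega)

lemma spaced (θ : ℕ → ℝ) (N : ℕ) (l : ℝ) (h : ∀ k, k + 1 < N → l ≤ θ (k+1) - θ k) (p q : ℕ)
    (hpq : p ≤ q) (hq : q < N) : l * ((q:ℝ) - p) ≤ θ q - θ p := by
  induction q, hpq using Nat.le_induction with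
  | base => simp
  | succ n hn ih =>
    have := ih (by omega)
    have := h n hq
    push_cast
    linarith

/-- van der Corput's second derivative test, discrete form. -/
lemma vdc (f : ℕ → ℝ) (N : ℕ) (l K : ℝ) (hl : 0 < l) (hK : 0 ≤ K)
    (h1 : ∀ k, k + 1 < N → l ≤ (f (k+2) - f (k+1)) - (f (k+1) - f k))
    (h2 : ∀ k, k + 1 < N → (f (k+2) - f (k+1)) - (f (k+1) - f k) ≤ K * l) :
    ‖∑ k ∈ range N, ee (f k)‖ ≤ (K * l * N + 2) * (3 / √l + 2) := by
  rcases Nat.eq_zero_or_pos N with rfl | hN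
  · simp; positivity
  set θ : ℕ → ℝ := fun k => f (k+1) - f k with hθ
  have hsp : ∀ p q, p ≤ q → q < N → l * ((q:ℝ) - p) ≤ θ q - θ p :=
    fun p q hpq hq => spaced θ N l h1 p q hpq hq
  have hmono : ∀ p q, p ≤ q → q < N → θ p ≤ θ q := by
    intro p q hpq hq
    have := hsp p q hpq hq
    have : (0:ℝ) ≤ (q:ℝ) - p := by
      have : (p:ℝ) ≤ q := by exact_mod_cast hpq
      linarith
    nlinarith
  have hup : θ (N-1) - θ 0 ≤ K * l * N := by
    have := spaced (fun k => - θ k) N (-(K * l)) (fun k hk => by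
      have := h2 k hk; simp only [hθ]; linarith) 0 (N-1) (by omega) (by omega)
    rw [Nat.cast_sub (by omega)] at this
    push_cast at this
    have : 0 ≤ K * l := by positivity
    nlinarith
  set δ := √l with hδd
  have hδ : 0 < δ := Real.sqrt_pos.2 hl
  have hδl : δ / l = 1 / δ := by
    rw [div_eq_div_iff hl.ne' hδ.ne', one_mul]; exact Real.mul_self_sqrt hl.le
  have hmaps : ∀ k ∈ range N, ⌊θ k⌋ ∈ Icc ⌊θ 0⌋ ⌊θ (N-1)⌋ := by
    intro k hk
    rw [mem_range] at hk
    rw [mem_Icc]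
    exact ⟨Int.floor_le_floor (hmono 0 k (by omega) hk),
      Int.floor_le_floor (hmono k (N-1) (by omega) (by omega))⟩
  -- small pieces
  have hsmall : ∀ a : ℝ, (#{k ∈ range N | a ≤ θ k ∧ θ k < a + δ} : ℝ) ≤ 1 / δ + 1 := by
    intro a
    obtain ⟨p, q, hpq, hS⟩ := ordconv_eq_Ico {k ∈ range N | a ≤ θ k ∧ θ k < a + δ} (by
      intro x hx y hy z hxz hzy
      simp only [mem_filter, mem_range] at *
      refine ⟨by omega, hx.2.1.trans (hmono x z hxz (by omega)), (hmono z y hzy (by omega)).trans_lt hy.2.2⟩)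
    rw [hS, Nat.card_Ico, Nat.cast_sub hpq]
    rcases hpq.eq_or_lt with rfl | hlt
    · simp; positivity
    have m1 : p ∈ Ico p q := by simp [hlt]
    have m2 : q - 1 ∈ Ico p q := by rw [mem_Ico]; omega
    rw [← hS] at m1 m2
    simp only [mem_filter, mem_range] at m1 m2
    have := hsp p (q-1) (by omega) m2.1
    rw [Nat.cast_sub (by omega)] at this
    push_cast at this
    have h3 : l * ((q:ℝ) - 1 - p) ≤ δ := by linarith
    have h4 : (q:ℝ) - 1 - p ≤ δ / l := by rw [le_div_iff₀ hl]; linarith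
    rw [hδl] at h4
    linarith
  have hpiece : ∀ j : ℤ, ‖∑ k ∈ range N with ⌊θ k⌋ = j, ee (f k)‖ ≤ 3 / δ + 2 := by
    intro j
    have hsplit : ∑ k ∈ range N with ⌊θ k⌋ = j, ee (f k)
        = ∑ k ∈ {k ∈ range N | ⌊θ k⌋ = j} with ((j:ℝ) + δ ≤ θ k ∧ θ k < j + 1 - δ), ee (f k)
          + ∑ k ∈ {k ∈ range N | ⌊θ k⌋ = j} with ¬ ((j:ℝ) + δ ≤ θ k ∧ θ k < j + 1 - δ), ee (f k) :=
      (sum_filter_add_sum_filter_not _ _ _).symm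
    rw [hsplit]
    have hB : ‖∑ k ∈ {k ∈ range N | ⌊θ k⌋ = j} with ¬ ((j:ℝ) + δ ≤ θ k ∧ θ k < j + 1 - δ), ee (f k)‖
        ≤ 2 * (1/δ + 1) := by
      refine (norm_sum_le _ _).trans ?_
      simp only [ee_norm, sum_const, nsmul_eq_mul, mul_one]
      have hsub : ({k ∈ {k ∈ range N | ⌊θ k⌋ = j} | ¬ ((j:ℝ) + δ ≤ θ k ∧ θ k < j + 1 - δ)})
          ⊆ {k ∈ range N | (j:ℝ) ≤ θ k ∧ θ k < j + δ} ∪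
            {k ∈ range N | ((j:ℝ) + 1 - δ) ≤ θ k ∧ θ k < ((j:ℝ) + 1 - δ) + δ} := by
        intro k hk
        simp only [mem_filter, mem_union, mem_range, Int.floor_eq_iff, not_and_or, not_le, not_lt] at *
        obtain ⟨⟨a, b, c⟩, d | d⟩ := hk
        · left; exact ⟨a, b, d⟩
        · right; exact ⟨a, d, by linarith⟩
      have hcard := (card_le_card hsub).trans (card_union_le _ _)
      have : (#({k ∈ {k ∈ range N | ⌊θ k⌋ = j} | ¬ ((j:ℝ) + δ ≤ θ k ∧ θ k < j + 1 - δ)}) : ℝ) ≤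
        #{k ∈ range N | (j:ℝ) ≤ θ k ∧ θ k < j + δ} +
            #{k ∈ range N | ((j:ℝ) + 1 - δ) ≤ θ k ∧ θ k < ((j:ℝ) + 1 - δ) + δ} := by exact_mod_cast hcard
      linarith [hsmall j, hsmall (j + 1 - δ)]
    have hA : ‖∑ k ∈ {k ∈ range N | ⌊θ k⌋ = j} with ((j:ℝ) + δ ≤ θ k ∧ θ k < j + 1 - δ), ee (f k)‖ ≤ 1/δ := by
      obtain ⟨p, q, hpq, hS⟩ := ordconv_eq_Ico {k ∈ {k ∈ range N | ⌊θ k⌋ = j} | ((j:ℝ) + δ ≤ θ k ∧ θ k < j + 1 - δ)} (by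
        intro x hx y hy z hxz hzy
        simp only [mem_filter, mem_range, Int.floor_eq_iff] at *
        have u1 := hmono x z hxz (by omega)
        have u2 := hmono z y hzy (by omega)
        exact ⟨⟨by omega, by linarith, by linarith⟩, by linarith, by linarith⟩)
      have hmem : ∀ k, k < q - p → (p + k < N ∧ (j:ℝ) + δ ≤ θ (p+k) ∧ θ (p+k) < j + 1 - δ) := by
        intro k hk
        have : p + k ∈ Ico p q := by rw [mem_Ico]; omega
        rw [← hS] at this
        simp only [mem_filter, mem_range] at this
        exact ⟨this.1.1, this.2⟩
      rw [hS, sum_Ico_eq_sum_range]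
      apply kuzmin_landau (fun k => f (p + k)) (q - p) j δ hδ
      · intro k hk
        exact hmono (p+k) (p+(k+1)) (by omega) (hmem (k+1) hk).1
      · intro k hk; exact (hmem k hk).2.1
      · intro k hk; exact (hmem k hk).2.2.le
    have := norm_add_le (∑ k ∈ {k ∈ range N | ⌊θ k⌋ = j} with ((j:ℝ) + δ ≤ θ k ∧ θ k < j + 1 - δ), ee (f k)) (∑ k ∈ {k ∈ range N | ⌊θ k⌋ = j} with ¬ ((j:ℝ) + δ ≤ θ k ∧ θ k < j + 1 - δ), ee (f k))
    have e3 : 3 / δ = 1/δ + 2 * (1/δ) := by ring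
    linarith
  rw [← sum_fiberwise_of_maps_to hmaps]
  refine (norm_sum_le _ _).trans ((sum_le_sum fun j _ => hpiece j).trans ?_)
  rw [sum_const, nsmul_eq_mul]
  apply mul_le_mul_of_nonneg_right _ (by positivity)
  have hle : ⌊θ 0⌋ ≤ ⌊θ (N-1)⌋ := Int.floor_le_floor (hmono 0 (N-1) (by omega) (by omega))
  rw [Int.card_Icc]
  have : (((⌊θ (N-1)⌋ + 1 - ⌊θ 0⌋).toNat : ℤ) : ℝ) = ⌊θ (N-1)⌋ + 1 - ⌊θ 0⌋ := by
    rw [Int.toNat_of_nonneg (by omega)]; push_cast; ring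
  have this2 : ((⌊θ (N-1)⌋ + 1 - ⌊θ 0⌋).toNat : ℝ) = ⌊θ (N-1)⌋ + 1 - ⌊θ 0⌋ := by
    rw [← this]; norm_cast
  rw [this2]
  linarith [Int.floor_le (θ (N-1)), Int.lt_floor_add_one (θ 0)]

lemma ee_comp_hasDerivAt (φ : ℝ → ℝ) (d x : ℝ) (h : HasDerivAt φ d x) :
    HasDerivAt (fun t => ee (φ t)) ((d : ℂ) * (2 * Real.pi * Complex.I * ee (φ x))) x := by
  unfold ee
  have h2 := (((h.const_mul (2 * Real.pi)).ofReal_comp).mul_const Complex.I).cexp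
  refine h2.congr_deriv ?_
  push_cast; ring

lemma pi_ne : (Real.pi : ℂ) ≠ 0 := by exact_mod_cast Real.pi_ne_zero

lemma ee_sq_hasDerivAt (v : ℝ) (hv : v ≠ 0) :
    HasDerivAt (fun v : ℝ => ee (v^2) / (4 * Real.pi * Complex.I * v))
      (ee (v^2) - ee (v^2) / (4 * Real.pi * Complex.I * v^2)) v := by
  have h1 := ee_comp_hasDerivAt (fun v => v^2) _ v (hasDerivAt_pow 2 v)
  have h2 : HasDerivAt (fun v : ℝ => 4 * Real.pi * Complex.I * (v:ℂ)) (4 * Real.pi * Complex.I * 1) v :=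
    (Complex.ofRealCLM.hasDerivAt (x := v)).const_mul _
  have hv' : (v:ℂ) ≠ 0 := by exact_mod_cast hv
  have hne : 4 * Real.pi * Complex.I * (v:ℂ) ≠ 0 := by
    simp [hv', pi_ne]
  refine (h1.div h2 hne).congr_deriv ?_
  have := pi_ne
  push_cast
  field_simp
  ring

lemma fresnel_tail (x y : ℝ) (hx : 0 < x) (hxy : x ≤ y) :
    ‖∫ v in x..y, ee (v^2)‖ ≤ 1 / x := by
  have hI : ∀ v ∈ Set.uIcc x y, v ≠ 0 := by
    intro v hv
    rw [Set.uIcc_of_le hxy] at hv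
    linarith [hv.1]
  have hc1 : Continuous fun v : ℝ => ee (v^2) := ee_continuous.comp (by fun_prop)
  have hpi4 : (4 * Real.pi * Complex.I : ℂ) ≠ 0 := by simp [pi_ne]
  have hc2 : ContinuousOn (fun v : ℝ => ee (v^2) / (4 * Real.pi * Complex.I * v^2)) (Set.uIcc x y) := by
    apply ContinuousOn.div hc1.continuousOn (by fun_prop)
    intro v hv
    have : (v:ℂ) ≠ 0 := by exact_mod_cast hI v hv
    simp [this, pi_ne]
  have h := intervalIntegral.integral_eq_sub_of_hasDerivAt (a := x) (b := y)
    (fun v hv => ee_sq_hasDerivAt v (hI v hv))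
    ((hc1.continuousOn.sub hc2).intervalIntegrable)
  rw [intervalIntegral.integral_sub hc1.continuousOn.intervalIntegrable hc2.intervalIntegrable] at h
  have hn : ∀ v : ℝ, 0 < v → ‖ee (v^2) / (4 * Real.pi * Complex.I * v)‖ ≤ (1/4) * (1 / v) := by
    intro v hv
    rw [norm_div, ee_norm]
    simp only [norm_mul, Complex.norm_I, Complex.norm_real, Real.norm_eq_abs, abs_of_pos hv, abs_of_pos Real.pi_pos]
    rw [show (1/4:ℝ) * (1/v) = 1 / (4 * v) by field_simp]
    apply one_div_le_one_div_of_le (by positivity)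
    have := Real.pi_gt_three
    simp
    nlinarith
  have hy : 0 < y := by linarith
  have hIntegral : ‖∫ v in x..y, ee (v^2) / (4 * Real.pi * Complex.I * v^2)‖ ≤ (1/4) * (1/x - 1/y) := by
    have hd : ∀ v ∈ Set.uIcc x y, HasDerivAt (fun v : ℝ => -(1/4) * (1/v)) ((1/4) * (1/v^2)) v := by
      intro v hv
      have := (hasDerivAt_inv (hI v hv)).const_mul (-(1/4:ℝ))
      have e : (fun v : ℝ => -(1/4) * (1/v)) = fun y : ℝ => -(1/4) * y⁻¹ := by
        funext y; rw [one_div y]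
      rw [e]
      refine this.congr_deriv ?_
      field_simp
    have hcc : ContinuousOn (fun v : ℝ => (1/4:ℝ) * (1/v^2)) (Set.uIcc x y) := by
      apply ContinuousOn.mul continuousOn_const
      apply ContinuousOn.div continuousOn_const (by fun_prop)
      intro v hv
      exact pow_ne_zero 2 (hI v hv)
    have h2 := intervalIntegral.integral_eq_sub_of_hasDerivAt hd hcc.intervalIntegrable
    have h3 : ‖∫ v in x..y, ee (v^2) / (4 * Real.pi * Complex.I * v^2)‖ ≤ ∫ v in x..y, (1/4:ℝ) * (1/v^2) := by
      apply intervalIntegral.norm_integral_le_of_norm_le hxy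
      · filter_upwards with v hv
        have hv0 : 0 < v := by linarith [hv.1]
        rw [norm_div, ee_norm]
        simp only [norm_mul, norm_pow, Complex.norm_I, Complex.norm_real, Real.norm_eq_abs, abs_of_pos hv0, abs_of_pos Real.pi_pos]
        rw [show (1/4:ℝ) * (1/v^2) = 1 / (4 * v^2) by field_simp]
        apply one_div_le_one_div_of_le (by positivity)
        have := Real.pi_gt_three
        simp
        nlinarith [sq_nonneg v]
      · exact hcc.intervalIntegrable
    rw [h2] at h3
    linarith
  have e : ∫ v in x..y, ee (v^2) = (ee (y^2) / (4 * Real.pi * Complex.I * y) - ee (x^2) / (4 * Real.pi * Complex.I * x)) + ∫ v in x..y, ee (v^2) / (4 * Real.pi * Complex.I * v^2) := by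
    rw [← h]; ring
  rw [e]
  have n1 := norm_add_le (ee (y^2) / (4 * Real.pi * Complex.I * y) - ee (x^2) / (4 * Real.pi * Complex.I * x)) (∫ v in x..y, ee (v^2) / (4 * Real.pi * Complex.I * v^2))
  have n2 := norm_sub_le (ee (y^2) / (4 * Real.pi * Complex.I * y)) (ee (x^2) / (4 * Real.pi * Complex.I * x))
  have := hn x hx
  have := hn y hy
  have : 0 < 1/x := by positivity
  linarith

noncomputable def fres (y : ℝ) : ℂ := ∫ v in (0:ℝ)..y, ee (v^2)

lemma ee_sq_int (x y : ℝ) : IntervalIntegrable (fun v : ℝ => ee (v^2)) MeasureTheory.volume x y :=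
  (ee_continuous.comp (by fun_prop : Continuous fun v : ℝ => v^2)).intervalIntegrable _ _

lemma fres_sub (x y : ℝ) : fres y - fres x = ∫ v in x..y, ee (v^2) :=
  intervalIntegral.integral_interval_sub_left (ee_sq_int _ _) (ee_sq_int _ _)

lemma fres_neg (y : ℝ) : fres (-y) = - fres y := by
  unfold fres
  have := intervalIntegral.integral_comp_neg (a := 0) (b := y) (fun v : ℝ => ee (v^2))
  simp only [neg_sq, neg_zero] at this
  rw [this, intervalIntegral.integral_symm]

lemma fres_bound_nonneg (y : ℝ) (hy : 0 ≤ y) : ‖fres y‖ ≤ 2 := by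
  have base : ∀ z : ℝ, 0 ≤ z → ‖fres z‖ ≤ z := by
    intro z hz
    have := intervalIntegral.norm_integral_le_of_norm_le_const (a := 0) (b := z) (C := 1) (f := fun v : ℝ => ee (v^2)) (fun v _ => (ee_norm _).le)
    simpa [fres, abs_of_nonneg hz] using this
  rcases le_total y 1 with h | h
  · linarith [base y hy]
  · have h1 := fresnel_tail 1 y one_pos h
    rw [← fres_sub] at h1
    have h2 := base 1 zero_le_one
    have h3 := norm_add_le (fres y - fres 1) (fres 1)
    rw [sub_add_cancel] at h3
    linarith

lemma fres_bound (y : ℝ) : ‖fres y‖ ≤ 2 := by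
  rcases le_total 0 y with h | h
  · exact fres_bound_nonneg y h
  · have := fres_bound_nonneg (-y) (by linarith)
    rwa [fres_neg, norm_neg] at this

lemma fres_limit : ∃ c : ℂ, ∀ y : ℝ, 0 < y → ‖fres y - c‖ ≤ 1 / y := by
  have hc : CauchySeq fun n : ℕ => fres ((n:ℝ) + 1) := by
    refine cauchySeq_of_le_tendsto_0 (fun n : ℕ => 2 / ((n:ℝ) + 1)) ?_ ?_
    · intro n m N hn hm
      have hN : (0:ℝ) < (N:ℝ) + 1 := by positivity
      have key : ∀ n : ℕ, N ≤ n → ‖fres ((n:ℝ) + 1) - fres ((N:ℝ)+1)‖ ≤ 1 / ((N:ℝ)+1) := by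
        intro n hn
        rw [fres_sub]
        exact fresnel_tail _ _ hN (by have : (N:ℝ) ≤ n := by exact_mod_cast hn
                                      linarith)
      rw [dist_eq_norm]
      have := norm_sub_le (fres ((n:ℝ) + 1) - fres ((N:ℝ)+1)) (fres ((m:ℝ) + 1) - fres ((N:ℝ)+1))
      rw [sub_sub_sub_cancel_right] at this
      have e : 2 / ((N:ℝ) + 1) = 1 / ((N:ℝ)+1) + 1 / ((N:ℝ)+1) := by ring
      linarith [key n hn, key m hm]
    · have := (tendsto_one_div_add_atTop_nhds_zero_nat (𝕜 := ℝ)).const_mul 2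
      simpa [div_eq_mul_inv] using this
  obtain ⟨c, hc⟩ := cauchySeq_tendsto_of_complete hc
  refine ⟨c, fun y hy => ?_⟩
  rw [norm_sub_rev]
  refine le_of_tendsto ((hc.sub_const (fres y)).norm) ?_
  obtain ⟨n0, hn0⟩ := exists_nat_ge y
  filter_upwards [Filter.eventually_ge_atTop n0] with n hn
  rw [fres_sub]
  apply fresnel_tail _ _ hy
  have : (n0:ℝ) ≤ n := by exact_mod_cast hn
  linarith

lemma fres_scale (k b0 x y : ℝ) (hk : 0 < k) :
    ∫ u in x..y, ee (k * (u - b0)^2) = (1/√k : ℝ) * (fres (√k * (y - b0)) - fres (√k * (x - b0))) := by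
  have hs : √k ≠ 0 := (Real.sqrt_pos.2 hk).ne'
  have h1 : ∀ u : ℝ, ee (k * (u - b0)^2) = (fun v : ℝ => ee (v^2)) (√k * u - √k * b0) := by
    intro u
    simp only
    rw [← mul_sub, mul_pow, Real.sq_sqrt hk.le]
  rw [intervalIntegral.integral_congr (fun u _ => h1 u)]
  rw [intervalIntegral.integral_comp_mul_sub (fun v : ℝ => ee (v^2)) hs (√k * b0), fres_sub, ← mul_sub, ← mul_sub, Complex.real_smul]
  simp

lemma quad_int_bound (k b0 x y : ℝ) (hk : 0 < k) :
    ‖∫ u in x..y, ee (k * (u - b0)^2)‖ ≤ 4 / √k := by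
  rw [fres_scale _ _ _ _ hk, norm_mul, Complex.norm_real, Real.norm_eq_abs, abs_of_pos (by positivity)]
  have := norm_sub_le (fres (√k * (y - b0))) (fres (√k * (x - b0)))
  have h1 := fres_bound (√k * (y - b0))
  have h2 := fres_bound (√k * (x - b0))
  rw [div_mul_eq_mul_div, one_mul]
  gcongr
  linarith

/-- The limiting Fresnel constant. -/
noncomputable def fc : ℂ := Classical.choose fres_limit
lemma fc_spec (y : ℝ) (hy : 0 < y) : ‖fres y - fc‖ ≤ 1 / y := Classical.choose_spec fres_limit y hy

lemma fc_bound : ‖fc‖ ≤ 3 := by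
  have h := fc_spec 1 one_pos
  have h2 := fres_bound 1
  have := norm_sub_le (fres 1) (fres 1 - fc)
  rw [sub_sub_cancel] at this
  norm_num at h
  linarith

lemma quad_int_full (k b0 : ℝ) (hk : 0 < k) :
    ‖(∫ u in (b0 - 1/(4*k))..(b0 + 1/(4*k)), ee (k * (u - b0)^2)) - (2 / √k : ℝ) * fc‖ ≤ 8 := by
  have hs : 0 < √k := Real.sqrt_pos.2 hk
  rw [fres_scale _ _ _ _ hk]
  have e1 : √k * (b0 + 1/(4*k) - b0) = 1 / (4 * √k) := by
    have := Real.mul_self_sqrt hk.le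
    rw [add_sub_cancel_left]
    field_simp
    nlinarith
  have e2 : √k * (b0 - 1/(4*k) - b0) = - (1 / (4 * √k)) := by
    rw [← e1]; ring
  rw [e1, e2, fres_neg]
  have e3 : ((1 / √k : ℝ):ℂ) * (fres (1 / (4 * √k)) - -fres (1 / (4 * √k))) - ((2 / √k : ℝ):ℂ) * fc
      = ((2 / √k : ℝ):ℂ) * (fres (1 / (4 * √k)) - fc) := by push_cast; ring
  rw [e3, norm_mul, Complex.norm_real, Real.norm_eq_abs, abs_of_pos (by positivity)]
  have := fc_spec (1 / (4 * √k)) (by positivity)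
  rw [one_div_one_div] at this
  calc _ ≤ 2 / √k * (4 * √k) := by gcongr
    _ = 8 := by field_simp; norm_num

-- the comparison of sums and integrals
noncomputable def sfun (θ : ℝ) : ℂ := ∫ t in (0:ℝ)..1, ee (θ * t)
noncomputable def rfun (θ : ℝ) : ℂ := ∫ t in (0:ℝ)..1, ((1 - t : ℝ) : ℂ) * ee (θ * t)

lemma sfun_mul (θ : ℝ) : ee θ - 1 = 2 * Real.pi * Complex.I * θ * sfun θ := by
  have hd : ∀ t ∈ Set.uIcc (0:ℝ) 1, HasDerivAt (fun t : ℝ => ee (θ * t)) ((θ:ℂ) * (2 * Real.pi * Complex.I * ee (θ * t))) t := by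
    intro t _
    have := ee_comp_hasDerivAt (fun t => θ * t) _ t ((hasDerivAt_id t).const_mul θ)
    simpa using this
  have hc : Continuous fun t : ℝ => (θ:ℂ) * (2 * Real.pi * Complex.I * ee (θ * t)) := by
    have := ee_continuous
    fun_prop
  have := intervalIntegral.integral_eq_sub_of_hasDerivAt hd (hc.intervalIntegrable _ _)
  simp only [mul_one, mul_zero, ee_zero] at this
  rw [← this, intervalIntegral.integral_const_mul, intervalIntegral.integral_const_mul]
  unfold sfun; ring

lemma rfun_mul (θ : ℝ) : 1 - sfun θ = - (2 * Real.pi * Complex.I * θ * rfun θ) := by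
  have hd : ∀ t ∈ Set.uIcc (0:ℝ) 1, HasDerivAt (fun t : ℝ => ((1 - t : ℝ) : ℂ) * ee (θ * t))
      (-1 * ee (θ * t) + ((1 - t : ℝ) : ℂ) * ((θ:ℂ) * (2 * Real.pi * Complex.I * ee (θ * t)))) t := by
    intro t _
    have h1 := ee_comp_hasDerivAt (fun t => θ * t) _ t ((hasDerivAt_id t).const_mul θ)
    simp only [mul_one] at h1
    have h2 : HasDerivAt (fun t : ℝ => ((1 - t : ℝ) : ℂ)) (-1) t := by
      have := ((hasDerivAt_id t).const_sub 1).ofReal_comp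
      simpa using this
    exact h2.mul h1
  have hce := ee_continuous
  have hc : Continuous fun t : ℝ => (-1 * ee (θ * t) + ((1 - t : ℝ) : ℂ) * ((θ:ℂ) * (2 * Real.pi * Complex.I * ee (θ * t)))) := by
    fun_prop
  have h := intervalIntegral.integral_eq_sub_of_hasDerivAt hd (hc.intervalIntegrable _ _)
  have h1 : Continuous fun t : ℝ => -1 * ee (θ * t) := by fun_prop
  have h2 : Continuous fun t : ℝ => ((1 - t : ℝ) : ℂ) * ((θ:ℂ) * (2 * Real.pi * Complex.I * ee (θ * t))) := by fun_prop
  rw [intervalIntegral.integral_add (h1.intervalIntegrable _ _) (h2.intervalIntegrable _ _),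
    intervalIntegral.integral_const_mul] at h
  have e : (fun t : ℝ => ((1 - t : ℝ) : ℂ) * ((θ:ℂ) * (2 * Real.pi * Complex.I * ee (θ * t))))
     = fun t : ℝ => (2 * Real.pi * Complex.I * θ) * (((1 - t : ℝ) : ℂ) * ee (θ * t)) := by
    funext t; ring
  rw [e, intervalIntegral.integral_const_mul] at h
  simp only [mul_zero, ee_zero] at h
  change -1 * (sfun θ) + 2 * Real.pi * Complex.I * θ * rfun θ = _ at h
  norm_num at h
  linear_combination h

lemma sfun_lip (a b : ℝ) : ‖sfun a - sfun b‖ ≤ 2 * Real.pi * |a - b| := by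
  have hce := ee_continuous
  unfold sfun
  rw [← intervalIntegral.integral_sub ((by fun_prop : Continuous fun t : ℝ => ee (a * t)).intervalIntegrable _ _)
    ((by fun_prop : Continuous fun t : ℝ => ee (b * t)).intervalIntegrable _ _)]
  have := intervalIntegral.norm_integral_le_of_norm_le_const (a := 0) (b := 1) (C := 2 * Real.pi * |a - b|)
    (f := fun t : ℝ => ee (a * t) - ee (b * t)) (by
      intro t ht
      rw [Set.uIoc_of_le zero_le_one] at ht
      refine (ee_sub_norm _ _).trans ?_
      rw [← sub_mul, abs_mul, abs_of_pos ht.1]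
      have : 0 ≤ |a - b| := abs_nonneg _
      have := Real.pi_pos
      have : |a-b| * t ≤ |a-b| := by nlinarith [ht.2]
      nlinarith)
  simpa using this

lemma rfun_lip (a b : ℝ) : ‖rfun a - rfun b‖ ≤ 2 * Real.pi * |a - b| := by
  have hce := ee_continuous
  unfold rfun
  rw [← intervalIntegral.integral_sub ((by fun_prop : Continuous fun t : ℝ => ((1 - t : ℝ) : ℂ) * ee (a * t)).intervalIntegrable _ _)
    ((by fun_prop : Continuous fun t : ℝ => ((1 - t : ℝ) : ℂ) * ee (b * t)).intervalIntegrable _ _)]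
  have := intervalIntegral.norm_integral_le_of_norm_le_const (a := 0) (b := 1) (C := 2 * Real.pi * |a - b|)
    (f := fun t : ℝ => ((1 - t : ℝ) : ℂ) * ee (a * t) - ((1 - t : ℝ) : ℂ) * ee (b * t)) (by
      intro t ht
      rw [Set.uIoc_of_le zero_le_one] at ht
      rw [← mul_sub, norm_mul, Complex.norm_real, Real.norm_eq_abs, abs_of_nonneg (by linarith [ht.2])]
      have h1 := ee_sub_norm (a * t) (b * t)
      rw [← sub_mul, abs_mul, abs_of_pos ht.1] at h1
      have : 0 ≤ |a - b| := abs_nonneg _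
      have := Real.pi_pos
      have : |a-b| * t ≤ |a-b| := by nlinarith [ht.2]
      have h2 : ‖ee (a * t) - ee (b * t)‖ ≤ 2 * Real.pi * |a - b| := by nlinarith
      nlinarith [ht.1, norm_nonneg (ee (a * t) - ee (b * t))])
  simpa using this

lemma sfun_zero : sfun 0 = 1 := by simp [sfun, ee_zero]

lemma rfun_bound (a : ℝ) : ‖rfun a‖ ≤ 1 := by
  unfold rfun
  have := intervalIntegral.norm_integral_le_of_norm_le_const (a := 0) (b := 1) (C := 1)
    (f := fun t : ℝ => ((1 - t : ℝ) : ℂ) * ee (a * t)) (by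
      intro t ht
      rw [Set.uIoc_of_le zero_le_one] at ht
      rw [norm_mul, ee_norm, mul_one, Complex.norm_real, Real.norm_eq_abs, abs_of_nonneg (by linarith [ht.2])]
      linarith [ht.1])
  simpa using this

lemma sfun_lower (a : ℝ) (h : |a| ≤ 1/2) : 1/2 ≤ ‖sfun a‖ := by
  rcases eq_or_ne a 0 with rfl | hne
  · rw [sfun_zero]; norm_num
  have h1 := congrArg norm (sfun_mul a)
  rw [ee_sub_one_norm] at h1
  simp only [norm_mul, Complex.norm_I, Complex.norm_real, Real.norm_eq_abs, abs_of_pos Real.pi_pos, Complex.norm_ofNat, mul_one] at h1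
  have h2 : 2 * |a| ≤ |Real.sin (Real.pi * a)| := by
    have := sin_pi_lower |a| (abs_nonneg _) h
    rcases abs_choice a with e | e <;> rw [e] at this ⊢
    · exact this.trans (le_abs_self _)
    · rw [mul_neg Real.pi, Real.sin_neg] at this
      exact this.trans (neg_le_abs _)
  have h3 : 0 < |a| := abs_pos.2 hne
  have hp := Real.pi_lt_four
  have h4 : 4 * |a| ≤ 2 * Real.pi * |a| * ‖sfun a‖ := by linarith
  have h5 : 4 ≤ 2 * Real.pi * ‖sfun a‖ := by
    by_contra hcon
    push Not at hcon
    nlinarith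
  have := norm_nonneg (sfun a)
  nlinarith

noncomputable def ufun (θ : ℝ) : ℂ := - (rfun θ / sfun θ)

lemma ufun_mul (θ : ℝ) (h : |θ| ≤ 1/2) : 1 - sfun θ = (ee θ - 1) * ufun θ := by
  have hs : sfun θ ≠ 0 := by
    intro h0
    have := sfun_lower θ h
    rw [h0, norm_zero] at this
    norm_num at this
  rw [rfun_mul, sfun_mul, ufun]
  field_simp

lemma ufun_bound (θ : ℝ) (h : |θ| ≤ 1/2) : ‖ufun θ‖ ≤ 2 := by
  rw [ufun, norm_neg, norm_div]
  have h1 := sfun_lower θ h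
  rw [div_le_iff₀ (by linarith)]
  linarith [rfun_bound θ]

lemma ufun_lip (a b : ℝ) (ha : |a| ≤ 1/2) (hb : |b| ≤ 1/2) : ‖ufun a - ufun b‖ ≤ 48 * |a - b| := by
  have h1 := sfun_lower a ha
  have h2 := sfun_lower b hb
  have hs : sfun a ≠ 0 := by
    intro h0; rw [h0, norm_zero] at h1; norm_num at h1
  have hs' : sfun b ≠ 0 := by
    intro h0; rw [h0, norm_zero] at h2; norm_num at h2
  have e : ufun a - ufun b = ((rfun b - rfun a) + ufun b * (sfun b - sfun a)) / sfun a := by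
    unfold ufun; field_simp; ring
  rw [e, norm_div, div_le_iff₀ (by linarith)]
  have h3 := norm_add_le (rfun b - rfun a) (ufun b * (sfun b - sfun a))
  rw [norm_mul] at h3
  have h4 := rfun_lip b a
  have h5 := sfun_lip b a
  have h6 := ufun_bound b hb
  rw [abs_sub_comm] at h4 h5
  have hp := Real.pi_lt_four
  have h0 := abs_nonneg (a - b)
  have h7 : 2 * Real.pi * |a - b| ≤ 8 * |a - b| := by nlinarith
  have h8 : ‖ufun b‖ * ‖sfun b - sfun a‖ ≤ 2 * (8 * |a-b|) := by
    apply mul_le_mul h6 (by linarith) (norm_nonneg _) (by norm_num)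
  nlinarith

lemma quad_step (k b0 b : ℝ) (hk : 0 ≤ k) :
    ‖ee (k * (b - b0)^2) * sfun (k * (2 * (b - b0) + 1)) - ∫ u in b..(b+1), ee (k * (u - b0)^2)‖ ≤ 8 * k := by
  have hce := ee_continuous
  have h1 : ∫ u in b..(b+1), ee (k * (u - b0)^2) = ∫ t in (0:ℝ)..1, ee (k * (t + b - b0)^2) := by
    rw [intervalIntegral.integral_comp_add_right (fun u => ee (k * (u - b0)^2)) b]
    congr 1 <;> ring
  rw [h1, sfun, ← intervalIntegral.integral_const_mul, ← intervalIntegral.integral_sub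
    ((by fun_prop : Continuous fun t : ℝ => ee (k * (b - b0) ^ 2) * ee (k * (2 * (b - b0) + 1) * t)).intervalIntegrable _ _)
    ((by fun_prop : Continuous fun t : ℝ => ee (k * (t + b - b0)^2)).intervalIntegrable _ _)]
  have := intervalIntegral.norm_integral_le_of_norm_le_const (a := 0) (b := 1) (C := 8 * k)
    (f := fun t : ℝ => ee (k * (b - b0) ^ 2) * ee (k * (2 * (b - b0) + 1) * t) - ee (k * (t + b - b0)^2)) (by
      intro t ht
      rw [Set.uIoc_of_le zero_le_one] at ht
      rw [← ee_add]
      refine (ee_sub_norm _ _).trans ?_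
      have e : k * (b - b0) ^ 2 + k * (2 * (b - b0) + 1) * t - k * (t + b - b0) ^ 2 = k * (t * (1 - t)) := by ring
      rw [e, abs_of_nonneg (mul_nonneg hk (mul_nonneg ht.1.le (by linarith [ht.2])))]
      have hp := Real.pi_lt_four
      have : t * (1 - t) ≤ 1 := by nlinarith [ht.1, ht.2]
      have h0 : k * (t * (1-t)) ≤ k := by nlinarith
      have h00 : 0 ≤ k * (t * (1-t)) := (mul_nonneg hk (mul_nonneg ht.1.le (by linarith [ht.2])))
      nlinarith [Real.pi_pos])
  simpa using this

/-- sum minus integral for a quadratic phase is bounded -/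
lemma quad_sum_int_range (k b0 : ℝ) (hk : 0 < k) (hk1 : k ≤ 1) (p N : ℕ)
    (h : ∀ i, i < N → |k * (2 * (((p + i : ℕ) : ℝ) - b0) + 1)| ≤ 1/2) :
    ‖∑ i ∈ range N, ee (k * (((p + i : ℕ) : ℝ) - b0)^2) - ∫ u in (p:ℝ)..((p + N : ℕ) : ℝ), ee (k * (u - b0)^2)‖ ≤ 100 := by
  rcases N with _ | N
  · simp
  have hce := ee_continuous
  set z : ℕ → ℂ := fun i => ee (k * (((p + i : ℕ) : ℝ) - b0)^2) with hz
  set θ : ℕ → ℝ := fun i => k * (2 * (((p + i : ℕ) : ℝ) - b0) + 1) with hθ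
  have hzs : ∀ i, z (i+1) = z i * ee (θ i) := by
    intro i
    simp only [hz, hθ]
    rw [← ee_add]; congr 1; push_cast; ring
  have hNk : 2 * k * N ≤ 1 := by
    have a1 := abs_le.1 (h 0 (by omega))
    have a2 := abs_le.1 (h N (by omega))
    push_cast at a1 a2
    nlinarith [a1.1, a2.2]
  have hIntegral : ∫ u in (p:ℝ)..((p + (N+1) : ℕ) : ℝ), ee (k * (u - b0)^2)
      = ∑ i ∈ range (N+1), ∫ u in (((p + i : ℕ) : ℝ))..(((p + i : ℕ) : ℝ) + 1), ee (k * (u - b0)^2) := by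
    have := intervalIntegral.sum_integral_adjacent_intervals (f := fun u => ee (k * (u - b0)^2)) (a := fun i : ℕ => ((p + i : ℕ) : ℝ)) (n := N+1) (μ := MeasureTheory.volume) (by
      intro i _
      exact (by fun_prop : Continuous fun u : ℝ => ee (k * (u - b0)^2)).intervalIntegrable _ _)
    simp only [add_zero] at this
    rw [← this]
    apply sum_congr rfl
    intro i _
    push_cast
    rw [add_assoc]
  rw [hIntegral, ← sum_sub_distrib]
  have hterm : ∀ i ∈ range (N+1), z i - ∫ u in (((p + i : ℕ) : ℝ))..(((p + i : ℕ) : ℝ) + 1), ee (k * (u - b0)^2)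
      = (z (i+1) - z i) * ufun (θ i) + (z i * sfun (θ i) - ∫ u in (((p + i : ℕ) : ℝ))..(((p + i : ℕ) : ℝ) + 1), ee (k * (u - b0)^2)) := by
    intro i hi
    have := ufun_mul (θ i) (h i (mem_range.1 hi))
    rw [hzs]
    linear_combination (z i) * this
  rw [sum_congr rfl hterm, sum_add_distrib]
  have hA := abel_bound z (fun i => ufun (θ i)) N (fun i => (ee_norm _).le)
  have hA2 : ∑ i ∈ range N, ‖ufun (θ (i+1)) - ufun (θ i)‖ ≤ 48 := by
    calc _ ≤ ∑ i ∈ range N, 48 * (2 * k) := by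
          apply sum_le_sum
          intro i hi
          rw [mem_range] at hi
          refine (ufun_lip _ _ (h _ (by omega)) (h _ (by omega))).trans ?_
          have : θ (i+1) - θ i = 2 * k := by simp only [hθ]; push_cast; ring
          rw [this, abs_of_pos (by positivity)]
      _ ≤ 48 := by rw [sum_const, card_range, nsmul_eq_mul]; nlinarith
  have hA3 := ufun_bound (θ N) (h N (by omega))
  have hA4 := ufun_bound (θ 0) (h 0 (by omega))
  have hB : ‖∑ i ∈ range (N+1), (z i * sfun (θ i) - ∫ u in (((p + i : ℕ) : ℝ))..(((p + i : ℕ) : ℝ) + 1), ee (k * (u - b0)^2))‖ ≤ 12 := by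
    refine (norm_sum_le _ _).trans ?_
    calc _ ≤ ∑ i ∈ range (N+1), 8 * k := sum_le_sum fun i _ => quad_step k b0 _ hk.le
      _ ≤ 12 := by rw [sum_const, card_range, nsmul_eq_mul]; push_cast; nlinarith
  refine (norm_add_le _ _).trans ?_
  linarith

lemma quad_sum_int (k b0 : ℝ) (hk : 0 < k) (hk1 : k ≤ 1) (p q : ℕ) (hpq : p ≤ q)
    (h : ∀ b, p ≤ b → b < q → |(b:ℝ) - b0| ≤ 1 / (4 * k)) :
    ‖∑ b ∈ Ico p q, ee (k * ((b:ℝ) - b0)^2) - ∫ u in (p:ℝ)..(q:ℝ), ee (k * (u - b0)^2)‖ ≤ 102 := by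
  have hce := ee_continuous
  obtain ⟨N, rfl⟩ := Nat.exists_eq_add_of_le hpq
  rw [sum_Ico_eq_sum_range, Nat.add_sub_cancel_left]
  rcases N with _ | N
  · simp
  have h1 := quad_sum_int_range k b0 hk hk1 p N (by
    intro i hi
    have a1 := abs_le.1 (h (p + i) (by omega) (by omega))
    have a2 := abs_le.1 (h (p + i + 1) (by omega) (by omega))
    have e : k * (1 / (4 * k)) = 1/4 := by field_simp
    push_cast at a1 a2 ⊢
    rw [abs_le]
    constructor
    · nlinarith [a1.1, a2.1]
    · nlinarith [a1.2, a2.2])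
  have hc : Continuous fun u : ℝ => ee (k * (u - b0)^2) := by fun_prop
  rw [sum_range_succ]
  have h2 : ∫ u in (p:ℝ)..((p + (N+1) : ℕ):ℝ), ee (k * (u - b0)^2) = (∫ u in (p:ℝ)..((p + N : ℕ):ℝ), ee (k * (u - b0)^2)) + ∫ u in ((p + N : ℕ):ℝ)..((p + (N+1) : ℕ):ℝ), ee (k * (u - b0)^2) :=
    (intervalIntegral.integral_add_adjacent_intervals (hc.intervalIntegrable _ _) (hc.intervalIntegrable _ _)).symm
  rw [h2]
  have h3 := intervalIntegral.norm_integral_le_of_norm_le_const (a := ((p + N : ℕ):ℝ)) (b := ((p + (N+1) : ℕ):ℝ)) (C := 1) (f := fun u : ℝ => ee (k * (u - b0)^2)) (fun v _ => (ee_norm _).le)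
  have h4 : |((p + (N+1) : ℕ):ℝ) - ((p + N : ℕ):ℝ)| = 1 := by push_cast; norm_num
  rw [h4] at h3
  have h5 := ee_norm (k * (((p + N : ℕ):ℝ) - b0)^2)
  generalize ee (k * (((p + N : ℕ):ℝ) - b0)^2) = A at *
  generalize (∫ u in ((p + N : ℕ):ℝ)..((p + (N+1) : ℕ):ℝ), ee (k * (u - b0)^2)) = B at *
  have e : ∀ S I : ℂ, S + A - (I + B) = (S - I) + (A - B) := by intros; ring
  rw [e]
  refine (norm_add_le _ _).trans ?_
  have := norm_sub_le A B
  linarith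

lemma quad_sum_bound (k b0 : ℝ) (hk : 0 < k) (hk1 : k ≤ 1) (p q : ℕ) (hpq : p ≤ q)
    (h : ∀ b, p ≤ b → b < q → |(b:ℝ) - b0| ≤ 1 / (4 * k)) :
    ‖∑ b ∈ Ico p q, ee (k * ((b:ℝ) - b0)^2)‖ ≤ 4 / √k + 102 := by
  have h1 := quad_sum_int k b0 hk hk1 p q hpq h
  have h2 := quad_int_bound k b0 p q hk
  have := norm_add_le (∑ b ∈ Ico p q, ee (k * ((b:ℝ) - b0)^2) - ∫ u in (p:ℝ)..(q:ℝ), ee (k * (u - b0)^2)) (∫ u in (p:ℝ)..(q:ℝ), ee (k * (u - b0)^2))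
  rw [sub_add_cancel] at this
  linarith

lemma int_dist (k b0 x y : ℝ) : ‖∫ u in x..y, ee (k * (u - b0)^2)‖ ≤ |y - x| := by
  have := intervalIntegral.norm_integral_le_of_norm_le_const (a := x) (b := y) (C := 1) (f := fun u : ℝ => ee (k * (u - b0)^2)) (fun v _ => (ee_norm _).le)
  simpa using this

lemma quad_sum_full (k b0 : ℝ) (hk : 0 < k) (hk1 : k ≤ 1) (h0 : 0 ≤ b0 - 1/(4*k)) :
    ‖∑ b ∈ Ico ⌈b0 - 1/(4*k)⌉₊ ⌈b0 + 1/(4*k)⌉₊, ee (k * ((b:ℝ) - b0)^2) - (2 / √k : ℝ) * fc‖ ≤ 112 := by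
  have hce := ee_continuous
  have hc : Continuous fun u : ℝ => ee (k * (u - b0)^2) := by fun_prop
  have hk4 : 0 < 1 / (4*k) := by positivity
  set x := b0 - 1/(4*k)
  set y := b0 + 1/(4*k)
  have hpq : ⌈x⌉₊ ≤ ⌈y⌉₊ := Nat.ceil_le_ceil (by simp only [x, y]; linarith)
  have h1 := quad_sum_int k b0 hk hk1 ⌈x⌉₊ ⌈y⌉₊ hpq (by
    intro b hb1 hb2
    rw [Nat.ceil_le] at hb1
    rw [Nat.lt_ceil] at hb2
    rw [abs_le]
    constructor
    · simp only [x] at hb1; linarith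
    · simp only [y] at hb2; linarith)
  have h2 := quad_int_full k b0 hk
  have e : (∫ u in (⌈x⌉₊:ℝ)..(⌈y⌉₊:ℝ), ee (k * (u - b0)^2)) = (∫ u in (⌈x⌉₊:ℝ)..x, ee (k * (u - b0)^2)) + (∫ u in x..y, ee (k * (u - b0)^2)) + (∫ u in y..(⌈y⌉₊:ℝ), ee (k * (u - b0)^2)) := by
    rw [intervalIntegral.integral_add_adjacent_intervals (hc.intervalIntegrable _ _) (hc.intervalIntegrable _ _), intervalIntegral.integral_add_adjacent_intervals (hc.intervalIntegrable _ _) (hc.intervalIntegrable _ _)]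
  have h3 := int_dist k b0 ⌈x⌉₊ x
  have h4 := int_dist k b0 y ⌈y⌉₊
  have h5 : |x - ⌈x⌉₊| ≤ 1 := by
    have := Nat.le_ceil x
    have := Nat.ceil_lt_add_one h0
    rw [abs_le]; constructor <;> linarith
  have h6 : |(⌈y⌉₊:ℝ) - y| ≤ 1 := by
    have := Nat.le_ceil y
    have := Nat.ceil_lt_add_one (show 0 ≤ y by simp only [x, y] at h0 ⊢; linarith)
    rw [abs_le]; constructor <;> linarith
  rw [e] at h1
  change ‖(∫ u in x..y, ee (k * (u - b0)^2)) - (2 / √k : ℝ) * fc‖ ≤ 8 at h2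
  generalize (∫ u in (⌈x⌉₊:ℝ)..x, ee (k * (u - b0)^2)) = A at *
  generalize (∫ u in x..y, ee (k * (u - b0)^2)) = B at *
  generalize (∫ u in y..(⌈y⌉₊:ℝ), ee (k * (u - b0)^2)) = D at *
  generalize ∑ b ∈ Ico ⌈x⌉₊ ⌈y⌉₊, ee (k * ((b:ℝ) - b0)^2) = S at *
  have e2 : S - (2 / √k : ℝ) * fc = (S - (A + B + D)) + (B - (2 / √k : ℝ) * fc) + A + D := by ring
  rw [e2]
  refine (norm_add_le _ _).trans ?_
  have n1 := norm_add_le (S - (A + B + D) + (B - (2 / √k : ℝ) * fc)) A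
  have n2 := norm_add_le (S - (A + B + D)) (B - (2 / √k : ℝ) * fc)
  linarith

noncomputable def psi (x : ℝ) : ℝ := Int.fract x - 1/2

lemma psi_abs (x : ℝ) : |psi x| ≤ 1/2 := by
  unfold psi
  rw [abs_le]
  constructor <;> linarith [Int.fract_nonneg x, Int.fract_lt_one x]

lemma psi_up (x v : ℝ) (hv : 0 ≤ v) : psi (x + v) ≤ psi x + v := by
  unfold psi Int.fract
  have : (⌊x⌋:ℝ) ≤ ⌊x + v⌋ := by exact_mod_cast Int.floor_le_floor (by linarith)
  linarith

lemma psi_measurable : Measurable psi := by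
  unfold psi
  exact measurable_fract.sub_const _

lemma psi_periodic : Function.Periodic psi 1 := by
  intro x; simp [psi]

lemma psi_intint (y a b : ℝ) : IntervalIntegrable (fun u => psi (y + u)) MeasureTheory.volume a b := by
  refine (intervalIntegrable_const (c := (1:ℝ))).mono_fun ?_ ?_
  · exact (psi_measurable.comp (measurable_const.add measurable_id)).aestronglyMeasurable
  · filter_upwards with u
    simp only [Real.norm_eq_abs, norm_one]
    linarith [psi_abs (y + u)]

lemma psi_ee_intint (y h a b : ℝ) : IntervalIntegrable (fun u => (psi (y + u) : ℂ) * ee (h * u)) MeasureTheory.volume a b := by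
  refine (intervalIntegrable_const (c := (1:ℝ))).mono_fun ?_ ?_
  · have h1 : Measurable fun u => (psi (y + u) : ℂ) :=
      Complex.measurable_ofReal.comp (psi_measurable.comp (measurable_const.add measurable_id))
    have h2 : Measurable fun u => ee (h * u) := (ee_continuous.comp (by fun_prop : Continuous fun u : ℝ => h * u)).measurable
    exact (h1.mul h2).aestronglyMeasurable
  · filter_upwards with u
    rw [norm_mul, ee_norm, Complex.norm_real, Real.norm_eq_abs, norm_one]
    linarith [psi_abs (y + u)]

noncomputable def Kf (h : ℤ) : ℂ := ∫ v in (0:ℝ)..1, (psi v : ℂ) * ee (h * v)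

lemma Kf_eq (h : ℤ) : Kf h = ∫ v in (0:ℝ)..1, ((v - 1/2 : ℝ) : ℂ) * ee (h * v) := by
  unfold Kf
  apply intervalIntegral.integral_congr_ae
  have : ∀ᵐ v : ℝ ∂MeasureTheory.volume, v ≠ 1 := by
    simp [MeasureTheory.ae_iff]
  filter_upwards [this] with v hv hv2
  rw [Set.uIoc_of_le zero_le_one] at hv2
  have : Int.fract v = v := Int.fract_eq_self.2 ⟨hv2.1.le, lt_of_le_of_ne hv2.2 hv⟩
  rw [psi, this]

lemma Kf_zero : Kf 0 = 0 := by
  rw [Kf_eq]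
  simp only [Int.cast_zero, zero_mul, ee_zero, mul_one]
  rw [intervalIntegral.integral_ofReal]
  norm_num [integral_id]

lemma Kf_bound (h : ℤ) (hh : h ≠ 0) : ‖Kf h‖ ≤ 1 / (6 * |(h:ℝ)|) := by
  have hh' : (h:ℂ) ≠ 0 := by exact_mod_cast hh
  set D : ℂ := 2 * Real.pi * Complex.I * h with hD
  have hD0 : D ≠ 0 := by simp [hD, pi_ne, hh']
  have hd : ∀ v ∈ Set.uIcc (0:ℝ) 1, HasDerivAt (fun v : ℝ => ((v - 1/2 : ℝ) : ℂ) * (ee (h * v) / D) - ee (h * v) / D^2)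
      (((v - 1/2 : ℝ) : ℂ) * ee (h * v)) v := by
    intro v _
    have h1 := ee_comp_hasDerivAt (fun t => (h:ℝ) * t) _ v ((hasDerivAt_id v).const_mul (h:ℝ))
    have h2 : HasDerivAt (fun v : ℝ => ((v - 1/2 : ℝ) : ℂ)) 1 v := by
      have := ((hasDerivAt_id v).sub_const (1/2)).ofReal_comp
      simpa using this
    refine ((h2.mul (h1.div_const D)).sub (h1.div_const (D^2))).congr_deriv ?_
    field_simp
    rw [hD]
    push_cast
    ring
  have hce := ee_continuous
  have hc : Continuous fun v : ℝ => ((v - 1/2 : ℝ) : ℂ) * ee (h * v) := by fun_prop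
  rw [Kf_eq, intervalIntegral.integral_eq_sub_of_hasDerivAt hd (hc.intervalIntegrable _ _)]
  simp only [mul_one, mul_zero, ee_zero, ee_int]
  have e : (((1 - 1/2 : ℝ) : ℂ) * (1 / D) - 1 / D^2 - (((0 - 1/2 : ℝ) : ℂ) * (1 / D) - 1 / D^2)) = 1 / D := by
    push_cast; ring
  rw [e, norm_div, norm_one, hD]
  simp only [norm_mul, Complex.norm_I, Complex.norm_real, Real.norm_eq_abs, abs_of_pos Real.pi_pos, Complex.norm_ofNat, mul_one, Complex.norm_intCast]
  have : 0 < |(h:ℝ)| := abs_pos.2 (by exact_mod_cast hh)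
  apply one_div_le_one_div_of_le (by positivity)
  nlinarith [Real.pi_gt_three]

lemma psi_coeff (y : ℝ) (h : ℤ) :
    ∫ u in (-(1/2):ℝ)..(1/2), (psi (y + u) : ℂ) * ee (h * u) = ee (-(h * y)) * Kf h := by
  have h1 : ∀ u : ℝ, (psi (y + u) : ℂ) * ee (h * u) = (fun v : ℝ => ee (-(h * y)) * ((psi v : ℂ) * ee (h * v))) (y + u) := by
    intro u
    simp only
    have : ee (h * u) = ee (-(h*y)) * ee (h * (y + u)) := by
      rw [← ee_add]; congr 1; ring
    rw [this]; ring
  rw [intervalIntegral.integral_congr (fun u _ => h1 u),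
    intervalIntegral.integral_comp_add_left (fun v : ℝ => ee (-(h * y)) * ((psi v : ℂ) * ee (h * v))) y,
    intervalIntegral.integral_const_mul]
  congr 1
  have hper : Function.Periodic (fun v : ℝ => (psi v : ℂ) * ee (h * v)) 1 := by
    intro v
    simp only
    rw [psi_periodic v, mul_add, mul_one, ee_add_int]
  have := hper.intervalIntegral_add_eq (y + -(1/2)) 0
  rw [zero_add] at this
  unfold Kf
  rw [← this]
  congr 1
  ring

/-- The Fejér kernel. -/
noncomputable def Fej (H : ℕ) (u : ℝ) : ℝ := (1 / (H:ℝ)) * ‖∑ k ∈ range H, ee (k * u)‖^2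

lemma Fej_nonneg (H : ℕ) (u : ℝ) : 0 ≤ Fej H u := by unfold Fej; positivity

lemma ee_conj (x : ℝ) : (starRingEnd ℂ) (ee x) = ee (-x) := by
  unfold ee
  rw [← Complex.exp_conj]
  congr 1
  rw [map_mul, Complex.conj_ofReal, Complex.conj_I]
  push_cast
  ring

lemma Fej_expand (H : ℕ) (u : ℝ) : (Fej H u : ℂ) = (1 / (H:ℂ)) * ∑ k ∈ range H, ∑ l ∈ range H, ee (((k:ℤ) - (l:ℤ) : ℤ) * u) := by
  unfold Fej
  push_cast
  congr 1
  rw [← Complex.conj_mul', mul_comm, map_sum, sum_mul_sum]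
  apply sum_congr rfl; intro k _
  apply sum_congr rfl; intro l _
  rw [ee_conj, ← ee_add]
  congr 1; ring

lemma Fej_continuous (H : ℕ) : Continuous (Fej H) := by
  unfold Fej
  have := ee_continuous
  fun_prop

lemma ee_int_integral (h : ℤ) : ∫ u in (-(1/2):ℝ)..(1/2), ee (h * u) = if h = 0 then 1 else 0 := by
  split_ifs with h0
  · subst h0
    simp [ee_zero]
    norm_num
  · have hper : Function.Periodic (fun v : ℝ => ee (h * v)) 1 := by
      intro v
      simp only
      rw [mul_add, mul_one, ee_add_int]
    have := hper.intervalIntegral_add_eq (-(1/2)) 0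
    rw [zero_add, show -(1/2) + (1:ℝ) = 1/2 by norm_num] at this
    rw [this]
    have h2 := sfun_mul h
    rw [ee_int, sub_self] at h2
    have hh' : (h:ℂ) ≠ 0 := by exact_mod_cast h0
    have h3 : (2 * Real.pi * Complex.I * ((h:ℝ):ℂ)) ≠ 0 := by simp [pi_ne, hh']
    exact (mul_eq_zero.1 h2.symm).resolve_left h3

lemma Fej_integral (H : ℕ) (hH : 1 ≤ H) : ∫ u in (-(1/2):ℝ)..(1/2), Fej H u = 1 := by
  have hce := ee_continuous
  have : ((∫ u in (-(1/2):ℝ)..(1/2), Fej H u : ℝ) : ℂ) = 1 := by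
    rw [← intervalIntegral.integral_ofReal]
    simp_rw [Fej_expand]
    rw [intervalIntegral.integral_const_mul, intervalIntegral.integral_finsetSum]
    · have : ∀ k ∈ range H, ∫ u in (-(1/2):ℝ)..(1/2), ∑ l ∈ range H, ee (((k:ℤ) - (l:ℤ) : ℤ) * u) = 1 := by
        intro k hk
        rw [intervalIntegral.integral_finsetSum]
        · simp_rw [ee_int_integral, sub_eq_zero]
          rw [sum_eq_single k]
          · simp
          · intro b _ hb
            rw [if_neg]
            intro h; apply hb; exact_mod_cast h.symm
          · intro h; exact absurd hk h
        · intro l _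
          exact (by fun_prop : Continuous fun u : ℝ => ee (((k:ℤ) - (l:ℤ) : ℤ) * u)).intervalIntegrable _ _
      rw [sum_congr rfl this]
      have : (H:ℂ) ≠ 0 := by
        have : H ≠ 0 := by omega
        exact_mod_cast this
      simp [this]
    · intro k _
      exact (by fun_prop : Continuous fun u : ℝ => ∑ l ∈ range H, ee (((k:ℤ) - (l:ℤ) : ℤ) * u)).intervalIntegrable _ _
  exact_mod_cast this

lemma Fej_decay (H : ℕ) (u : ℝ) (hu : |u| ≤ 1/2) (h0 : u ≠ 0) : Fej H u ≤ (1 / (H:ℝ)) * (1 / (4 * u^2)) := by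
  unfold Fej
  apply mul_le_mul_of_nonneg_left _ (by positivity)
  have h1 : (∑ k ∈ range H, ee (k * u)) * (ee u - 1) = ee (H * u) - 1 := by
    have := geom_sum_mul (ee u) H
    rw [show ee (H * u) = ee u ^ H by
      unfold ee; rw [← Complex.exp_nat_mul]; congr 1; push_cast; ring, ← this]
    congr 1
    apply sum_congr rfl
    intro k _
    unfold ee; rw [← Complex.exp_nat_mul]; congr 1; push_cast; ring
  have h2 := congrArg norm h1
  rw [norm_mul] at h2
  have h3 : ‖ee (H * u) - 1‖ ≤ 2 := by
    refine (norm_sub_le _ _).trans ?_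
    rw [ee_norm, norm_one]; norm_num
  have h4 : 4 * |u| ≤ ‖ee u - 1‖ := by
    rw [ee_sub_one_norm]
    have := sin_pi_lower |u| (abs_nonneg _) hu
    rcases abs_choice u with e | e <;> rw [e] at this ⊢
    · linarith [le_abs_self (Real.sin (Real.pi * u))]
    · rw [mul_neg Real.pi, Real.sin_neg] at this
      linarith [neg_le_abs (Real.sin (Real.pi * u))]
  have h5 : 0 < |u| := abs_pos.2 h0
  have h6 := norm_nonneg (∑ k ∈ range H, ee (k * u))
  set A := ‖∑ k ∈ range H, ee (k * u)‖
  have h7 : A * (2 * |u|) ≤ 1 := by nlinarith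
  rw [le_div_iff₀ (by positivity)]
  have : A^2 * (4 * u^2) = (A * (2 * |u|))^2 := by rw [mul_pow, mul_pow, sq_abs]; ring
  rw [this]
  have : 0 ≤ A * (2 * |u|) := by positivity
  nlinarith

lemma lor_integral (d : ℝ) (hd : 0 < d) : ∫ u in (-(1/2):ℝ)..(1/2), 1 / (u^2 + d^2) ≤ 4 / d := by
  have hder : ∀ u ∈ Set.uIcc (-(1/2):ℝ) (1/2), HasDerivAt (fun u : ℝ => (1/d) * Real.arctan (u / d)) (1 / (u^2 + d^2)) u := by
    intro u _
    have h1 := ((hasDerivAt_id u).div_const d).arctan.const_mul (1/d)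
    refine h1.congr_deriv ?_
    simp only [id]
    have : u^2 + d^2 ≠ 0 := by positivity
    have : 1 + (u/d)^2 ≠ 0 := by positivity
    field_simp
    ring
  have hc : Continuous fun u : ℝ => 1 / (u^2 + d^2) := by
    apply Continuous.div continuous_const (by fun_prop)
    intro u; positivity
  rw [intervalIntegral.integral_eq_sub_of_hasDerivAt hder (hc.intervalIntegrable _ _)]
  have h1 := Real.arctan_lt_pi_div_two ((1/2) / d)
  have h2 := Real.neg_pi_div_two_lt_arctan (-(1/2) / d)
  have h3 := Real.pi_lt_four
  rw [← mul_sub, div_mul_eq_mul_div, one_mul]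
  gcongr
  linarith

lemma fejer_core (H : ℕ) (hH : 1 ≤ H) (G : ℝ → ℝ) (M y T c : ℝ) 
    (hGi : IntervalIntegrable (fun u => G u * Fej H u) MeasureTheory.volume (-(1/2)) (1/2))
    (hM : ∀ u, |G u| ≤ M) (hyM : y ≤ M) (hc0 : 0 ≤ c)
    (hG : ∀ u, |u| ≤ 8 / (H:ℝ) → y - c ≤ G u)
    (hT0 : 0 ≤ T)
    (hT : |∫ u in (-(1/2):ℝ)..(1/2), G u * Fej H u| ≤ T) :
    y ≤ T + c + M / 2 := by
  have hM0 : 0 ≤ M := (abs_nonneg _).trans (hM 0)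
  rcases le_or_gt y c with h | hyc
  · linarith
  have hHr : (0:ℝ) < H := by exact_mod_cast hH
  set d : ℝ := 8 / H with hd
  have hd0 : 0 < d := by positivity
  set R : ℝ → ℝ := fun u => (1 / (2 * H)) * (1 / (u^2 + d^2)) with hR
  have hRc : Continuous R := by
    simp only [hR]
    apply Continuous.mul continuous_const
    apply Continuous.div continuous_const (by fun_prop)
    intro u; positivity
  have hFc := Fej_continuous H
  have hle : ∫ u in (-(1/2):ℝ)..(1/2), ((y - c) * Fej H u - 2 * M * R u) ≤ ∫ u in (-(1/2):ℝ)..(1/2), G u * Fej H u := by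
    apply intervalIntegral.integral_mono_on (by norm_num) _ hGi
    · intro u hu
      have hF := Fej_nonneg H u
      have hR0 : 0 ≤ R u := by simp only [hR]; positivity
      rcases le_or_gt |u| d with hud | hud
      · have := hG u hud
        nlinarith
      · have h1 : Fej H u ≤ R u := by
          have hu0 : u ≠ 0 := by
            intro h0; rw [h0, abs_zero] at hud; linarith
          have h2 := Fej_decay H u (abs_le.2 ⟨by linarith [hu.1], hu.2⟩) hu0
          refine h2.trans ?_
          simp only [hR]
          rw [div_mul_div_comm, div_mul_div_comm]
          have h3 : d^2 ≤ u^2 := by rw [← sq_abs u]; gcongr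
          have : 0 < u^2 := by positivity
          apply div_le_div_of_nonneg_left (by norm_num) (by positivity)
          nlinarith
        have h2 := (abs_le.1 (hM u)).1
        nlinarith
    · exact (by fun_prop : Continuous fun u => (y - c) * Fej H u - 2 * M * R u).intervalIntegrable _ _
  rw [intervalIntegral.integral_sub ((by fun_prop : Continuous fun u => (y - c) * Fej H u).intervalIntegrable _ _)
    ((by fun_prop : Continuous fun u => 2 * M * R u).intervalIntegrable _ _),
    intervalIntegral.integral_const_mul, intervalIntegral.integral_const_mul, Fej_integral H hH] at hle
  have hRi : ∫ u in (-(1/2):ℝ)..(1/2), R u ≤ 1/4 := by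
    simp only [hR]
    rw [intervalIntegral.integral_const_mul]
    have := lor_integral d hd0
    calc _ ≤ (1 / (2 * (H:ℝ))) * (4 / d) := by gcongr
      _ = 1/4 := by rw [hd]; field_simp; norm_num
  have := (abs_le.1 hT).2
  nlinarith

lemma ii_sum_c {κ : Type*} (s : Finset κ) (f : κ → ℝ → ℂ) (a b : ℝ) (hf : ∀ i ∈ s, IntervalIntegrable (f i) MeasureTheory.volume a b) :
    IntervalIntegrable (fun u => ∑ i ∈ s, f i u) MeasureTheory.volume a b := by
  have e : (fun u => ∑ i ∈ s, f i u) = ∑ i ∈ s, f i := by funext u; simp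
  rw [e]; exact IntervalIntegrable.sum s hf

lemma ii_sum_r {κ : Type*} (s : Finset κ) (f : κ → ℝ → ℝ) (a b : ℝ) (hf : ∀ i ∈ s, IntervalIntegrable (f i) MeasureTheory.volume a b) :
    IntervalIntegrable (fun u => ∑ i ∈ s, f i u) MeasureTheory.volume a b := by
  have e : (fun u => ∑ i ∈ s, f i u) = ∑ i ∈ s, f i := by funext u; simp
  rw [e]; exact IntervalIntegrable.sum s hf

lemma diff_sum (v : ℕ → ℝ) (hv : ∀ j, 0 ≤ v j) (H k : ℕ) :
    ∑ l ∈ range H, v ((k:ℤ) - (l:ℤ)).natAbs ≤ 2 * ∑ j ∈ range (max H (k+1)), v j := by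
  have hmaps : ∀ l ∈ range H, ((k:ℤ) - (l:ℤ)).natAbs ∈ range (max H (k+1)) := by
    intro l hl
    rw [mem_range] at *
    omega
  rw [← sum_fiberwise_of_maps_to hmaps, mul_sum]
  apply sum_le_sum
  intro j _
  rw [sum_congr rfl (g := fun _ => v j) (by intro l hl; rw [(mem_filter.1 hl).2]), sum_const, nsmul_eq_mul]
  apply mul_le_mul_of_nonneg_right _ (hv j)
  have hsub : (range H).filter (fun l : ℕ => ((k:ℤ) - (l:ℤ)).natAbs = j) ⊆ ({k - j, k + j} : Finset ℕ) := by
    intro l hl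
    simp only [mem_filter, mem_insert, mem_singleton] at *
    omega
  exact_mod_cast (card_le_card hsub).trans card_le_two

lemma fejer {ι : Type*} (P : Finset ι) (x : ι → ℝ) (H : ℕ) (hH : 1 ≤ H) :
    |∑ i ∈ P, psi (x i)| ≤ 32 * #P / H + ∑ h ∈ Ico 1 H, (1 / (h:ℝ)) * ‖∑ i ∈ P, ee (h * x i)‖ := by
  have hHr : (0:ℝ) < H := by exact_mod_cast hH
  set g : ℝ → ℝ := fun t => ∑ i ∈ P, psi (x i + t) with hg
  set v : ℕ → ℝ := fun j => (1 / (6 * (j:ℝ))) * ‖∑ i ∈ P, ee (j * x i)‖ with hv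
  have hv0 : ∀ j, 0 ≤ v j := fun j => by simp only [hv]; positivity
  set T := 2 * ∑ j ∈ range H, v j with hT
  have hT0 : 0 ≤ T := by
    have := sum_nonneg (s := range H) fun j _ => hv0 j
    simp only [hT]; linarith
  have hFc := Fej_continuous H
  have hce := ee_continuous
  -- integral bound
  have hIntegral : ∀ t, |∫ u in (-(1/2):ℝ)..(1/2), g (t + u) * Fej H u| ≤ T := by
    intro t
    rw [← Real.norm_eq_abs, ← Complex.norm_real, ← intervalIntegral.integral_ofReal]
    have e1 : ∀ u : ℝ, ((g (t + u) * Fej H u : ℝ) : ℂ) = (1 / (H:ℂ)) * ∑ k ∈ range H, ∑ l ∈ range H, ∑ i ∈ P, (psi (x i + t + u) : ℂ) * ee (((k:ℤ) - (l:ℤ) : ℤ) * u) := by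
      intro u
      rw [Complex.ofReal_mul, Fej_expand]
      simp only [hg]
      rw [mul_left_comm, mul_sum]
      congr 1
      apply sum_congr rfl; intro k _
      rw [mul_sum]
      apply sum_congr rfl; intro l _
      push_cast
      rw [sum_mul]
      simp only [add_assoc]
    rw [intervalIntegral.integral_congr (fun u _ => e1 u), intervalIntegral.integral_const_mul]
    have hii : ∀ k l : ℕ, ∀ i ∈ P, IntervalIntegrable (fun u : ℝ => (psi (x i + t + u) : ℂ) * ee (((k:ℤ) - (l:ℤ) : ℤ) * u)) MeasureTheory.volume (-(1/2)) (1/2) :=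
      fun k l i _ => psi_ee_intint _ _ _ _
    rw [intervalIntegral.integral_finsetSum (fun k _ => by
      have h1 : ∀ l ∈ range H, IntervalIntegrable (fun u : ℝ => ∑ i ∈ P, (psi (x i + t + u) : ℂ) * ee (((k:ℤ) - (l:ℤ) : ℤ) * u)) MeasureTheory.volume (-(1/2)) (1/2) := by
        intro l _
        exact ii_sum_c P _ _ _ (hii k l)
      exact ii_sum_c (range H) _ _ _ h1)]
    rw [norm_mul]
    have hk : ∀ k ∈ range H, ‖∫ u in (-(1/2):ℝ)..(1/2), ∑ l ∈ range H, ∑ i ∈ P, (psi (x i + t + u) : ℂ) * ee (((k:ℤ) - (l:ℤ) : ℤ) * u)‖ ≤ T := by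
      intro k hk
      rw [mem_range] at hk
      rw [intervalIntegral.integral_finsetSum (fun l _ => by
        exact ii_sum_c P _ _ _ (hii k l))]
      refine (norm_sum_le _ _).trans ?_
      have hd := diff_sum v hv0 H k
      rw [max_eq_left (by omega)] at hd
      refine le_trans (sum_le_sum fun l _ => ?_) hd
      rw [intervalIntegral.integral_finsetSum (hii k l)]
      simp_rw [psi_coeff]
      rw [← sum_mul, norm_mul]
      set h : ℤ := (k:ℤ) - (l:ℤ)
      by_cases hh : h = 0
      · rw [hh, Kf_zero, norm_zero, mul_zero]; exact hv0 _
      · have hK := Kf_bound h hh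
        have hn : ‖∑ i ∈ P, ee (-(h * (x i + t)))‖ = ‖∑ i ∈ P, ee (h.natAbs * x i)‖ := by
          have e2 : ∑ i ∈ P, ee (-(h * (x i + t))) = ee (-(h * t)) * ∑ i ∈ P, ee (-(h * x i)) := by
            rw [mul_sum]
            apply sum_congr rfl; intro i _
            rw [← ee_add]; congr 1; ring
          rw [e2, norm_mul, ee_norm, one_mul]
          rcases Int.natAbs_eq h with e | e
          · have e3 : ∑ i ∈ P, ee (-(h * x i)) = (starRingEnd ℂ) (∑ i ∈ P, ee (h.natAbs * x i)) := by
              rw [map_sum]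
              apply sum_congr rfl; intro i _
              rw [ee_conj]
              have : (h:ℝ) = (h.natAbs : ℝ) := by
                conv_lhs => rw [e]
                simp
              rw [this]
            rw [e3, Complex.norm_conj]
          · congr 1
            apply sum_congr rfl; intro i _
            have : (h:ℝ) = -(h.natAbs : ℝ) := by
              conv_lhs => rw [e]
              simp
            rw [this]; congr 1; ring
        rw [hn, mul_comm]
        simp only [hv]
        apply mul_le_mul_of_nonneg_right _ (norm_nonneg _)
        refine hK.trans (le_of_eq ?_)
        rw [Nat.cast_natAbs]; push_cast; rfl
    have := (norm_sum_le (range H) fun k => ∫ u in (-(1/2):ℝ)..(1/2), ∑ l ∈ range H, ∑ i ∈ P, (psi (x i + t + u) : ℂ) * ee (((k:ℤ) - (l:ℤ) : ℤ) * u)).trans (sum_le_sum hk)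
    rw [sum_const, card_range, nsmul_eq_mul] at this
    have e4 : ‖(1 / (H:ℂ))‖ = 1 / (H:ℝ) := by simp
    rw [e4, div_mul_eq_mul_div, one_mul, div_le_iff₀ hHr]
    linarith
  have hgi : ∀ t, IntervalIntegrable (fun u => g (t + u) * Fej H u) MeasureTheory.volume (-(1/2)) (1/2) := by
    intro t
    apply IntervalIntegrable.mul_continuousOn _ hFc.continuousOn
    have := ii_sum_r P _ _ _ (fun i _ => psi_intint (x i + t) (-(1/2)) (1/2))
    simp only [hg]
    simp only [add_assoc] at this
    exact this
  have hgb : ∀ t, |g t| ≤ #P := by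
    intro t
    refine (abs_sum_le_sum_abs _ _).trans ?_
    calc _ ≤ ∑ i ∈ P, (1:ℝ) := sum_le_sum fun i _ => by linarith [psi_abs (x i + t)]
      _ = _ := by simp
  have hgup : ∀ t w, 0 ≤ w → g (t + w) ≤ g t + #P * w := by
    intro t w hw
    simp only [hg]
    calc _ ≤ ∑ i ∈ P, (psi (x i + t) + w) := sum_le_sum fun i _ => by
          rw [← add_assoc]; exact psi_up _ _ hw
      _ = _ := by rw [sum_add_distrib]; simp
  set M := ⨆ t, |g t| with hM
  have hbdd : BddAbove (Set.range fun t => |g t|) := ⟨#P, by rintro _ ⟨t, rfl⟩; exact hgb t⟩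
  have hMle : ∀ t, |g t| ≤ M := fun t => le_ciSup hbdd t
  set d : ℝ := 8 / H with hd
  have hd0 : 0 < d := by positivity
  have hstep : ∀ t, |g t| ≤ T + 2 * #P * d + M / 2 := by
    intro t
    rw [abs_le']
    constructor
    · refine fejer_core H hH (fun u => g (t - d + u)) M (g t) T (2 * #P * d) (hgi _) (fun u => hMle _)
        ((le_abs_self _).trans (hMle t)) (by positivity) ?_ hT0 (hIntegral _)
      intro u hu
      rw [abs_le] at hu
      have := hgup (t - d + u) (d - u) (by linarith [hu.2])
      rw [show t - d + u + (d - u) = t by ring] at this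
      have h3 : (0:ℝ) ≤ #P := by positivity
      have h4 : -d ≤ u := hu.1
      nlinarith
    · refine fejer_core H hH (fun u => - g (t + d + u)) M (- g t) T (2 * #P * d) ?_ (fun u => by rw [abs_neg]; exact hMle _)
        ((neg_le_abs _).trans (hMle t)) (by positivity) ?_ hT0 ?_
      · have e9 : (fun u => -g (t + d + u) * Fej H u) = -(fun u => g (t + d + u) * Fej H u) := by
          funext u; simp
        rw [e9]
        exact (hgi (t + d)).neg
      · intro u hu
        rw [abs_le] at hu
        have := hgup t (d + u) (by linarith [hu.1])
        rw [show t + (d + u) = t + d + u by ring] at this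
        have h3 : (0:ℝ) ≤ #P := by positivity
        have h4 : u ≤ d := hu.2
        nlinarith
      · simp only [neg_mul, intervalIntegral.integral_neg, abs_neg]
        exact hIntegral _
  have hMfin : M ≤ T + 2 * #P * d + M / 2 := ciSup_le hstep
  have h0 := hMle 0
  simp only [hg, add_zero] at h0
  have hT2 : 2 * T ≤ ∑ h ∈ Ico 1 H, (1 / (h:ℝ)) * ‖∑ i ∈ P, ee (h * x i)‖ := by
    simp only [hT]
    have : range H = insert 0 (Ico 1 H) := by
      ext j; simp only [mem_range, mem_insert, mem_Ico]; omega
    rw [this, sum_insert (by simp)]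
    have h00 : v 0 = 0 := by simp [hv]
    rw [h00, zero_add, ← mul_assoc, mul_sum]
    apply sum_le_sum
    intro j hj
    have : (0:ℝ) < j := by exact_mod_cast (mem_Ico.1 hj).1
    simp only [hv]
    rw [← mul_assoc]
    apply mul_le_mul_of_nonneg_right _ (norm_nonneg _)
    rw [mul_one_div, div_le_div_iff₀ (by positivity) (by positivity)]
    linarith
  have e5 : 32 * (#P:ℝ) / H = 4 * #P * d := by rw [hd]; ring
  rw [e5]
  linarith

lemma abel_w (w : ℕ → ℝ) (z : ℕ → ℂ) (B : ℝ) (hw : Monotone w) (N : ℕ)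
    (hB : ∀ j ≤ N, ‖∑ k ∈ range j, z k‖ ≤ B) :
    ‖∑ k ∈ range N, (w k : ℂ) * z k - w N * ∑ k ∈ range N, z k‖ ≤ (w N - w 0) * B := by
  induction N with
  | zero => simp
  | succ N ih =>
    have h1 := ih fun j hj => hB j (by omega)
    have h2 : ∑ k ∈ range (N+1), (w k : ℂ) * z k - w (N+1) * ∑ k ∈ range (N+1), z k
        = (∑ k ∈ range N, (w k : ℂ) * z k - w N * ∑ k ∈ range N, z k) - ((w (N+1) - w N : ℝ) : ℂ) * ∑ k ∈ range (N+1), z k := by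
      rw [sum_range_succ, sum_range_succ]; push_cast; ring
    rw [h2]
    refine (norm_sub_le _ _).trans ?_
    have h3 := hw (Nat.le_succ N)
    rw [norm_mul, Complex.norm_real, Real.norm_eq_abs, abs_of_nonneg (by simpa using h3)]
    have h4 := mul_le_mul_of_nonneg_left (hB (N+1) le_rfl) (sub_nonneg.2 h3)
    simp only [Nat.succ_eq_add_one] at h4
    linarith

lemma abel_w2 (w : ℕ → ℝ) (z : ℕ → ℂ) (B : ℝ) (hw : Monotone w) (hw0 : 0 ≤ w 0) (N : ℕ)
    (hB : ∀ j ≤ N, ‖∑ k ∈ range j, z k‖ ≤ B) :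
    ‖∑ k ∈ range N, (w k : ℂ) * z k‖ ≤ 2 * w N * B := by
  have h1 := abel_w w z B hw N hB
  have h2 := hB N le_rfl
  have hB0 : 0 ≤ B := (norm_nonneg _).trans h2
  have hwN : 0 ≤ w N := hw0.trans (hw (Nat.zero_le _))
  have h3 : ‖(w N : ℂ) * ∑ k ∈ range N, z k‖ ≤ w N * B := by
    rw [norm_mul, Complex.norm_real, Real.norm_eq_abs, abs_of_nonneg hwN]
    gcongr
  have h4 := norm_add_le (∑ k ∈ range N, (w k : ℂ) * z k - w N * ∑ k ∈ range N, z k) (w N * ∑ k ∈ range N, z k)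
  rw [sub_add_cancel] at h4
  nlinarith [mul_nonneg hw0 hB0]

/-- The set of admissible second coordinates. -/
noncomputable def Fs (X : ℝ) (a : ℕ) : Finset ℕ := (Icc 1 a).filter fun b => 4 * (a:ℝ)^2 ≤ 4 * X + (b:ℝ)^2

noncomputable def Fm (X : ℝ) (a h m : ℕ) : Finset ℕ := (Fs X a).filter fun b => (h * b + a) / (2 * a) = m

lemma mem_Fm (X : ℝ) (a h m b : ℕ) (ha : 1 ≤ a) : b ∈ Fm X a h m ↔
    ((1 ≤ b ∧ b ≤ a) ∧ 4 * (a:ℝ)^2 ≤ 4 * X + (b:ℝ)^2) ∧ (2 * m * a ≤ h * b + a ∧ h * b < (2 * m + 1) * a) := by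
  unfold Fm Fs
  rw [mem_filter, mem_filter, mem_Icc, Nat.div_eq_iff (by omega)]
  apply and_congr_right
  intro _
  have e1 : m * (2 * a) = 2 * m * a := by ring
  have e2 : (2 * m + 1) * a = 2 * m * a + a := by ring
  rw [e1, e2]
  omega

def goodm (X : ℝ) (a h m : ℕ) : Prop := 1 ≤ m ∧ 2 * m + 1 ≤ h ∧ 4 * (h:ℝ)^2 * ((a:ℝ)^2 - X) ≤ (2 * (m:ℝ) - 1)^2 * (a:ℝ)^2

lemma Fm_sum_eq (X : ℝ) (a h m : ℕ) (ha : 1 ≤ a) (hh : 1 ≤ h) (S : Finset ℕ) :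
    ∑ b ∈ S, ee (h * ((b:ℝ)^2 / 4 / a)) =
    ee (-(a * (m:ℝ)^2 / h)) * ∑ b ∈ S, ee (((h:ℝ) / (4 * a)) * ((b:ℝ) - 2 * a * m / h)^2) := by
  have ha' : (0:ℝ) < a := by exact_mod_cast ha
  have hh' : (0:ℝ) < h := by exact_mod_cast hh
  rw [mul_sum]
  apply sum_congr rfl
  intro b _
  rw [← ee_add, ← mul_one (ee (-_ + _)), ← ee_nat (m * b), ← ee_add]
  congr 1
  push_cast
  field_simp
  ring

lemma sqrt_kap (a h : ℕ) (ha : 1 ≤ a) (hh : 1 ≤ h) : √((h:ℝ) / (4 * a)) = √h / (2 * √a) := by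
  rw [Real.sqrt_div' _ (by positivity), Real.sqrt_mul (by norm_num), show √(4:ℝ) = 2 by
    rw [show (4:ℝ) = 2^2 by norm_num]; exact Real.sqrt_sq (by norm_num)]

lemma Fm_bound (X : ℝ) (a h m : ℕ) (ha : 1 ≤ a) (hh : 1 ≤ h) (hha : h ≤ 4 * a) :
    ‖∑ b ∈ Fm X a h m, ee (h * ((b:ℝ)^2 / 4 / a))‖ ≤ 8 * √a / √h + 102 := by
  have ha' : (0:ℝ) < a := by exact_mod_cast ha
  have hh' : (0:ℝ) < h := by exact_mod_cast hh
  obtain ⟨p, q, hpq, hS⟩ := ordconv_eq_Ico (Fm X a h m) (by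
    intro x hx y hy z hxz hzy
    rw [mem_Fm _ _ _ _ _ ha] at *
    obtain ⟨⟨⟨h1, h2⟩, h3⟩, h4, h5⟩ := hx
    obtain ⟨⟨⟨g1, g2⟩, g3⟩, g4, g5⟩ := hy
    have k1 := Nat.mul_le_mul_left h hxz
    have k2 := Nat.mul_le_mul_left h hzy
    refine ⟨⟨⟨by omega, by omega⟩, ?_⟩, by omega, by omega⟩
    have : (x:ℝ) ≤ z := by exact_mod_cast hxz
    have : (x:ℝ)^2 ≤ (z:ℝ)^2 := by gcongr
    linarith)
  rw [Fm_sum_eq X a h m ha hh, norm_mul, ee_norm, one_mul, hS]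
  have := quad_sum_bound ((h:ℝ) / (4 * a)) (2 * a * m / h) (by positivity) (by
    rw [div_le_one (by positivity)]; exact_mod_cast hha) p q hpq (by
    intro b h1 h2
    have hb : b ∈ Fm X a h m := by rw [hS, mem_Ico]; exact ⟨h1, h2⟩
    rw [mem_Fm _ _ _ _ _ ha] at hb
    obtain ⟨_, h3, h4⟩ := hb
    have h3' : 2 * (m:ℝ) * a ≤ h * b + a := by exact_mod_cast h3
    have h4' : (h:ℝ) * b < (2 * m + 1) * a := by exact_mod_cast h4
    have e : 1 / (4 * ((h:ℝ) / (4 * a))) = a / h := by field_simp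
    have e2 : (b:ℝ) - 2 * a * m / h = (h * b - 2 * a * m) / h := by field_simp
    rw [e, e2, abs_div, abs_of_pos hh']
    gcongr
    rw [abs_le]; constructor <;> linarith)
  rw [sqrt_kap a h ha hh] at this
  have e : 4 / (√(h:ℝ) / (2 * √a)) = 8 * √a / √h := by
    have := Real.sqrt_pos.2 hh'
    have := Real.sqrt_pos.2 ha'
    field_simp; norm_num
  rwa [e] at this

lemma Fm_good (X : ℝ) (a h m : ℕ) (ha : 1 ≤ a) (hh : 1 ≤ h) (hha : h ≤ 4 * a) (hg : goodm X a h m) :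
    ‖∑ b ∈ Fm X a h m, ee (h * ((b:ℝ)^2 / 4 / a)) - ee (-(a * (m:ℝ)^2 / h)) * ((4 * √a / √h : ℝ) * fc)‖ ≤ 112 := by
  have ha' : (0:ℝ) < a := by exact_mod_cast ha
  have hh' : (0:ℝ) < h := by exact_mod_cast hh
  obtain ⟨g1, g2, g3⟩ := hg
  have g1' : (1:ℝ) ≤ m := by exact_mod_cast g1
  have g2' : 2 * (m:ℝ) + 1 ≤ h := by exact_mod_cast g2
  have e : 1 / (4 * ((h:ℝ) / (4 * a))) = a / h := by field_simp
  have hlo : 2 * (a:ℝ) * m / h - a / h = (2 * m - 1) * a / h := by field_simp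
  have hhi : 2 * (a:ℝ) * m / h + a / h = (2 * m + 1) * a / h := by field_simp
  have hS : Fm X a h m = Ico ⌈2 * (a:ℝ) * m / h - 1 / (4 * ((h:ℝ) / (4 * a)))⌉₊ ⌈2 * (a:ℝ) * m / h + 1 / (4 * ((h:ℝ) / (4 * a)))⌉₊ := by
    ext b
    rw [mem_Fm _ _ _ _ _ ha, mem_Ico, Nat.ceil_le, Nat.lt_ceil, e, hlo, hhi, div_le_iff₀ hh', lt_div_iff₀ hh']
    constructor
    · rintro ⟨_, h3, h4⟩
      have h3' : 2 * (m:ℝ) * a ≤ h * b + a := by exact_mod_cast h3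
      have h4' : (h:ℝ) * b < (2 * m + 1) * a := by exact_mod_cast h4
      constructor <;> linarith
    · rintro ⟨h3, h4⟩
      have h5 : 0 < (b:ℝ) * h := lt_of_lt_of_le (mul_pos (by linarith) ha') h3
      have h6 : 0 < (b:ℝ) := pos_of_mul_pos_left h5 hh'.le
      refine ⟨⟨⟨by exact_mod_cast h6, ?_⟩, ?_⟩, ?_, ?_⟩
      · have : (b:ℝ) * h < a * h := by nlinarith
        exact_mod_cast (lt_of_mul_lt_mul_right this hh'.le).le
      · have h7 : ((2 * (m:ℝ) - 1) * a)^2 ≤ (b * h)^2 := by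
          apply pow_le_pow_left₀ _ h3
          exact mul_nonneg (by linarith) ha'.le
        have h8 : (h:ℝ)^2 * (4 * ((a:ℝ)^2 - X)) ≤ (h:ℝ)^2 * (b:ℝ)^2 := by nlinarith
        have := le_of_mul_le_mul_left h8 (by positivity)
        linarith
      · have : 2 * (m:ℝ) * a ≤ h * b + a := by linarith
        exact_mod_cast this
      · have : (h:ℝ) * b < (2 * m + 1) * a := by linarith
        exact_mod_cast this
  rw [Fm_sum_eq X a h m ha hh, ← mul_sub, norm_mul, ee_norm, one_mul, hS]
  have := quad_sum_full ((h:ℝ) / (4 * a)) (2 * a * m / h) (by positivity) (by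
    rw [div_le_one (by positivity)]; exact_mod_cast hha) (by
      rw [e, hlo]; apply div_nonneg (mul_nonneg (by linarith) ha'.le) hh'.le)
  rw [sqrt_kap a h ha hh] at this
  have e : 2 / (√(h:ℝ) / (2 * √a)) = 4 * √a / √h := by
    have := Real.sqrt_pos.2 hh'
    have := Real.sqrt_pos.2 ha'
    field_simp; norm_num
  rwa [e] at this

open Classical in
lemma bad_card (X : ℝ) (a h : ℕ) (ha : 1 ≤ a) (hh : 1 ≤ h) :
    #{m ∈ range (h+1) | ¬ goodm X a h m ∧ (Fm X a h m).Nonempty} ≤ 3 := by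
  have ha' : (0:ℝ) < a := by exact_mod_cast ha
  have hh' : (0:ℝ) < h := by exact_mod_cast hh
  set B : Finset ℕ := (range (h+1)).filter (fun m : ℕ => 1 ≤ m ∧ (2 * (m:ℝ) - 1)^2 * (a:ℝ)^2 < 4 * (h:ℝ)^2 * ((a:ℝ)^2 - X) ∧ 4 * (h:ℝ)^2 * ((a:ℝ)^2 - X) < (2 * (m:ℝ) + 1)^2 * (a:ℝ)^2) with hB
  have hB1 : #B ≤ 1 := by
    rw [card_le_one]
    have key : ∀ m ∈ B, ∀ k ∈ B, ¬ m < k := by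
      intro m hm k hk hmk
      rw [hB, mem_filter] at hm hk
      have h1 : (2 * (m:ℝ) + 1) ≤ 2 * k - 1 := by
        have : (m:ℝ) + 1 ≤ k := by exact_mod_cast hmk
        linarith
      have h2 : (2 * (m:ℝ) + 1)^2 * (a:ℝ)^2 ≤ (2 * (k:ℝ) - 1)^2 * (a:ℝ)^2 := by gcongr
      linarith [hm.2.2.2, hk.2.2.1]
    intro m hm k hk
    have := key m hm k hk
    have := key k hk m hm
    omega
  have hsub : {m ∈ range (h+1) | ¬ goodm X a h m ∧ (Fm X a h m).Nonempty} ⊆ ({0, (h+1)/2} : Finset ℕ) ∪ B := by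
    intro m hm
    rw [mem_filter] at hm
    obtain ⟨hm0, hm1, b, hb⟩ := hm
    rw [mem_Fm _ _ _ _ _ ha] at hb
    obtain ⟨⟨⟨b1, b2⟩, b3⟩, b4, b5⟩ := hb
    rw [mem_union, mem_insert, mem_singleton]
    by_cases c1 : m = 0
    · left; left; exact c1
    by_cases c2 : 2 * m + 1 ≤ h
    · right
      rw [hB, mem_filter]
      refine ⟨hm0, by omega, ?_, ?_⟩
      · by_contra hcon
        exact hm1 ⟨by omega, c2, by linarith⟩
      · have b5' : (h:ℝ) * b < (2 * m + 1) * a := by exact_mod_cast b5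
        have h7 : ((h:ℝ) * b)^2 < ((2 * m + 1) * a)^2 := by
          apply pow_lt_pow_left₀ b5' (by positivity) (by norm_num)
        have h8 : (h:ℝ)^2 * (4 * ((a:ℝ)^2 - X)) ≤ (h:ℝ)^2 * (b:ℝ)^2 := by
          gcongr; linarith
        nlinarith
    · left; right
      have k1 := Nat.mul_le_mul_left h b2
      have : 2 * m * a ≤ (h + 1) * a := by
        calc _ ≤ _ := b4
          _ ≤ h * a + a := by omega
          _ = _ := by ring
      have := Nat.le_of_mul_le_mul_right this (by omega)
      omega
  calc _ ≤ _ := card_le_card hsub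
    _ ≤ _ := card_union_le _ _
    _ ≤ 2 + 1 := Nat.add_le_add card_le_two hB1

open Classical in
lemma inner_approx (X : ℝ) (a h : ℕ) (ha : 1 ≤ a) (hh : 1 ≤ h) (hha : h ≤ 4 * a) :
    ‖∑ b ∈ Fs X a, ee (h * ((b:ℝ)^2 / 4 / a)) - ∑ m ∈ range (h+1) with goodm X a h m, ee (-(a * (m:ℝ)^2 / h)) * ((4 * √a / √h : ℝ) * fc)‖
      ≤ 530 * h + 24 * √a / √h := by
  have ha' : (0:ℝ) < a := by exact_mod_cast ha
  have hh' : (1:ℝ) ≤ h := by exact_mod_cast hh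
  have hmaps : ∀ b ∈ Fs X a, (h * b + a) / (2 * a) ∈ range (h+1) := by
    intro b hb
    unfold Fs at hb
    rw [mem_filter, mem_Icc] at hb
    rw [mem_range, Nat.div_lt_iff_lt_mul (by omega)]
    have := Nat.mul_le_mul_left h hb.1.2
    nlinarith
  rw [← sum_fiberwise_of_maps_to hmaps, sum_filter, ← sum_sub_distrib]
  have hE : 0 ≤ 8 * √(a:ℝ) / √h + 102 := by positivity
  have hterm : ∀ m ∈ range (h+1), ‖∑ b ∈ Fs X a with (h * b + a) / (2 * a) = m, ee (h * ((b:ℝ)^2 / 4 / a)) -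
      (if goodm X a h m then ee (-(a * (m:ℝ)^2 / h)) * ((4 * √a / √h : ℝ) * fc) else 0)‖ ≤
      112 + if (¬ goodm X a h m ∧ (Fm X a h m).Nonempty) then 8 * √(a:ℝ) / √h + 102 else 0 := by
    intro m _
    change ‖∑ b ∈ Fm X a h m, _ - _‖ ≤ _
    by_cases hg : goodm X a h m
    · rw [if_pos hg, if_neg (by tauto), add_zero]
      exact Fm_good X a h m ha hh hha hg
    · rw [if_neg hg, sub_zero]
      by_cases hne : (Fm X a h m).Nonempty
      · rw [if_pos ⟨hg, hne⟩]
        linarith [Fm_bound X a h m ha hh hha]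
      · rw [not_nonempty_iff_eq_empty.1 hne]
        simp
  refine (norm_sum_le _ _).trans ((sum_le_sum hterm).trans ?_)
  rw [sum_add_distrib, ← sum_filter, sum_const, sum_const, card_range, nsmul_eq_mul, nsmul_eq_mul]
  have hbc := bad_card X a h ha hh
  have hbc' : ((#{m ∈ range (h+1) | ¬ goodm X a h m ∧ (Fm X a h m).Nonempty} : ℕ) : ℝ) ≤ 3 := by exact_mod_cast hbc
  have := mul_le_mul_of_nonneg_right hbc' hE
  push_cast
  have e : 24 * √(a:ℝ) / √h = 3 * (8 * √a / √h) := by ring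
  rw [e]
  nlinarith

lemma osc_sum (X : ℝ) (n h m p q : ℕ) (hh : 1 ≤ h) (hp : n ≤ 2 * p) (hp1 : 1 ≤ p) (hpq : p ≤ q) (hq : q ≤ n + 1)
    (hn1 : 1 ≤ n) (hX : 0 < X)
    (hnX : (n:ℝ)^2 ≤ 4 * X) (hhX : h * X ≤ 2 * (n:ℝ)^3) :
    ‖∑ a ∈ Ico p q, (√(a:ℝ) : ℂ) * ee (h * (X / a) - a * (m:ℝ)^2 / h)‖ ≤ 480 * √h * √X := by
  have hh' : (1:ℝ) ≤ h := by exact_mod_cast hh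
  have hn' : (1:ℝ) ≤ n := by exact_mod_cast hn1
  set l : ℝ := 2 * h * X / n^3 with hl
  have hl0 : 0 < l := by positivity
  have hl4 : l ≤ 4 := by rw [hl, div_le_iff₀ (by positivity)]; linarith
  have hln : 1 / 2 ≤ l * n := by
    have : l * n = 2 * h * X / n^2 := by rw [hl]; field_simp
    rw [this, le_div_iff₀ (by positivity)]
    nlinarith
  have hsl : 0 < √l := Real.sqrt_pos.2 hl0
  have hsl2 : √l ≤ 2 := by
    rw [show (2:ℝ) = √4 by rw [show (4:ℝ) = 2^2 by norm_num]; exact (Real.sqrt_sq (by norm_num)).symm]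
    exact Real.sqrt_le_sqrt hl4
  have hss : √l * √l = l := Real.mul_self_sqrt hl0.le
  set f : ℕ → ℝ := fun k => h * (X / ((p + k : ℕ) : ℝ)) - ((p + k : ℕ) : ℝ) * (m:ℝ)^2 / h with hf
  have hdiff : ∀ k, (f (k+2) - f (k+1)) - (f (k+1) - f k) = 2 * h * X / (((p + k : ℕ):ℝ) * ((p + k : ℕ) + 1) * ((p + k : ℕ) + 2)) := by
    intro k
    simp only [hf]
    have : (0:ℝ) < ((p + k : ℕ) : ℝ) := by exact_mod_cast (by omega : 0 < p + k)
    rw [show ((p + (k+2) : ℕ):ℝ) = ((p + k : ℕ):ℝ) + 2 by push_cast; ring,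
      show ((p + (k+1) : ℕ):ℝ) = ((p + k : ℕ):ℝ) + 1 by push_cast; ring]
    generalize ((p + k : ℕ):ℝ) = y at *
    field_simp
    ring
  have hB : ∀ j ≤ q - p, ‖∑ k ∈ range j, ee (f k)‖ ≤ 84 * n * √l := by
    intro j hj
    have hjn : (j:ℝ) ≤ n := by exact_mod_cast (by omega : j ≤ n)
    have hv := vdc f j l 8 hl0 (by norm_num) (by
      intro k hk
      rw [hdiff, hl]
      have h1 : ((p + k : ℕ):ℝ) + 1 ≤ n := by exact_mod_cast (by omega : p + k + 1 ≤ n)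
      have h0 : (0:ℝ) < ((p + k : ℕ) : ℝ) := by exact_mod_cast (by omega : 0 < p + k)
      generalize ((p + k : ℕ):ℝ) = y at *
      apply div_le_div_of_nonneg_left (by positivity) (by positivity)
      calc y * (y+1) * (y+2) ≤ (y+1)^3 := by nlinarith
        _ ≤ n^3 := by gcongr) (by
      intro k hk
      rw [hdiff, hl]
      have h1 : (n:ℝ) / 2 ≤ ((p + k : ℕ):ℝ) := by
        have : (n:ℝ) ≤ 2 * ((p + k : ℕ) : ℝ) := by exact_mod_cast (by omega : n ≤ 2 * (p + k))
        linarith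
      have h0 : (0:ℝ) < ((p + k : ℕ) : ℝ) := by exact_mod_cast (by omega : 0 < p + k)
      generalize ((p + k : ℕ):ℝ) = y at *
      rw [show 8 * (2 * h * X / (n:ℝ)^3) = 2 * h * X / ((n/2:ℝ)^3) by field_simp; norm_num]
      apply div_le_div_of_nonneg_left (by positivity) (by positivity)
      calc (n/2:ℝ)^3 ≤ y^3 := by gcongr
        _ ≤ y * (y+1) * (y+2) := by nlinarith [sq_nonneg y])
    have h1 : 8 * l * j + 2 ≤ 12 * l * n := by nlinarith
    have h2 : 3 / √l + 2 ≤ 7 / √l := by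
      rw [div_add' _ _ _ hsl.ne']
      gcongr
      linarith
    calc _ ≤ _ := hv
      _ ≤ (12 * l * n) * (7 / √l) := by gcongr
      _ = 84 * n * √l := by
        rw [← hss]; field_simp; norm_num
        ring
  have hA := abel_w2 (fun k => √((p + k : ℕ) : ℝ)) (fun k => ee (f k)) _ (by
    intro x y hxy
    apply Real.sqrt_le_sqrt
    exact_mod_cast (by omega : p + x ≤ p + y)) (Real.sqrt_nonneg _) (q - p) hB
  rw [sum_Ico_eq_sum_range]
  refine hA.trans ?_
  have hw : √((p + (q - p) : ℕ) : ℝ) ≤ 2 * √n := by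
    have : (2:ℝ) * √n = √(4 * n) := by
      rw [Real.sqrt_mul (by norm_num), show (4:ℝ) = 2^2 by norm_num, Real.sqrt_sq (by norm_num)]
    rw [this]
    apply Real.sqrt_le_sqrt
    exact_mod_cast (by omega : p + (q - p) ≤ 4 * n)
  have hfin : √(n:ℝ) * (n * √l) = √2 * √h * √X := by
    have e1 : √(n:ℝ) * (n * √l) = √(n * n^2 * l) := by
      rw [Real.sqrt_mul (by positivity), Real.sqrt_mul (by positivity), Real.sqrt_sq (by positivity)]; ring
    rw [e1, ← Real.sqrt_mul (by norm_num), ← Real.sqrt_mul (by positivity), hl]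
    congr 1
    field_simp
  have hs2 : √(2:ℝ) ≤ 1.42 := by
    rw [Real.sqrt_le_left (by norm_num)]; norm_num
  have hhX0 : 0 ≤ √(h:ℝ) * √X := by positivity
  calc 2 * √((p + (q - p) : ℕ) : ℝ) * (84 * n * √l) ≤ 2 * (2 * √n) * (84 * n * √l) := by gcongr
    _ = 336 * (√(n:ℝ) * (n * √l)) := by ring
    _ = 336 * (√2 * (√h * √X)) := by rw [hfin]; ring
    _ ≤ 336 * (1.42 * (√h * √X)) := by gcongr
    _ ≤ _ := by nlinarith

open Classical in
lemma S_bound (X : ℝ) (n M h : ℕ) (hh : 1 ≤ h) (hM : n ≤ 2 * M + 1) (hn1 : 1 ≤ n) (hX : 0 < X) (hhn : h ≤ 2 * n)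
    (hnX : (n:ℝ)^2 ≤ 4 * X) (hhX : h * X ≤ 2 * (n:ℝ)^3) :
    ‖∑ a ∈ Ioc M n, ∑ b ∈ Fs X a, ee (h * ((X + (b:ℝ)^2/4) / a))‖ ≤ 13000 * h * √X + 24 * (n * √n) / √h := by
  have hh' : (1:ℝ) ≤ h := by exact_mod_cast hh
  have hn' : (1:ℝ) ≤ n := by exact_mod_cast hn1
  have hsh : 0 < √(h:ℝ) := Real.sqrt_pos.2 (by linarith)
  have hshs : √(h:ℝ) * √h = h := Real.mul_self_sqrt (by linarith)
  have hnsX : (n:ℝ) ≤ 2 * √X := by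
    have : (2:ℝ) * √X = √(4 * X) := by
      rw [Real.sqrt_mul (by norm_num), show (4:ℝ) = 2^2 by norm_num, Real.sqrt_sq (by norm_num)]
    rw [this]; exact Real.le_sqrt_of_sq_le hnX
  -- main part
  set A : ℕ → ℂ := fun a => ∑ m ∈ range (h+1) with goodm X a h m, ee (-(a * (m:ℝ)^2 / h)) * ((4 * √a / √h : ℝ) * fc) with hA
  have h1 : ∀ a ∈ Ioc M n, ‖∑ b ∈ Fs X a, ee (h * ((X + (b:ℝ)^2/4) / a)) - ee (h * (X / a)) * A a‖ ≤ 530 * h + 24 * √n / √h := by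
    intro a ha
    rw [mem_Ioc] at ha
    have e : ∑ b ∈ Fs X a, ee (h * ((X + (b:ℝ)^2/4) / a)) = ee (h * (X / a)) * ∑ b ∈ Fs X a, ee (h * ((b:ℝ)^2 / 4 / a)) := by
      rw [mul_sum]
      apply sum_congr rfl; intro b _
      rw [← ee_add]; congr 1; ring
    rw [e, ← mul_sub, norm_mul, ee_norm, one_mul]
    refine (inner_approx X a h (by omega) hh (by omega)).trans ?_
    gcongr
    exact ha.2
  have h2 : ‖∑ a ∈ Ioc M n, ee (h * (X / a)) * A a‖ ≤ 11520 * h * √X := by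
    have e : ∑ a ∈ Ioc M n, ee (h * (X / a)) * A a = ∑ m ∈ range (h+1), ((4 / √h : ℝ) * fc) * ∑ a ∈ Ioc M n with goodm X a h m, (√(a:ℝ) : ℂ) * ee (h * (X / a) - a * (m:ℝ)^2 / h) := by
      simp only [hA, mul_sum, sum_filter]
      rw [sum_comm]
      apply sum_congr rfl; intro m _
      apply sum_congr rfl; intro a _
      split_ifs
      · rw [show (h * (X / a) - a * (m:ℝ)^2 / h) = h * (X / a) + -(a * (m:ℝ)^2 / h) by ring, ee_add]
        push_cast; ring
      · simp
    rw [e]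
    have hm : ∀ m ∈ range (h+1), ‖((4 / √h : ℝ) * fc) * ∑ a ∈ Ioc M n with goodm X a h m, (√(a:ℝ) : ℂ) * ee (h * (X / a) - a * (m:ℝ)^2 / h)‖ ≤ 5760 * √X := by
      intro m _
      obtain ⟨p, q, hpq, hS⟩ := ordconv_eq_Ico {a ∈ Ioc M n | goodm X a h m} (by
        intro x hx y hy z hxz hzy
        simp only [mem_filter, mem_Ioc] at *
        obtain ⟨hy1, g1, g2, g3⟩ := hy
        refine ⟨by omega, g1, g2, ?_⟩
        have h5 : (z:ℝ)^2 ≤ (y:ℝ)^2 := by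
          have : (z:ℝ) ≤ y := by exact_mod_cast hzy
          gcongr
        have g2' : 2 * (m:ℝ) + 1 ≤ h := by exact_mod_cast g2
        have g1' : (1:ℝ) ≤ m := by exact_mod_cast g1
        have h6 : 0 ≤ 4 * (h:ℝ)^2 - (2 * (m:ℝ) - 1)^2 := by nlinarith
        nlinarith [mul_le_mul_of_nonneg_left h5 h6])
      rw [norm_mul, norm_mul, Complex.norm_real, Real.norm_eq_abs, abs_of_pos (by positivity)]
      have hos : ‖∑ a ∈ Ioc M n with goodm X a h m, (√(a:ℝ) : ℂ) * ee (h * (X / a) - a * (m:ℝ)^2 / h)‖ ≤ 480 * √h * √X := by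
        rw [hS]
        rcases hpq.eq_or_lt with rfl | hlt
        · simp; positivity
        · have hp : p ∈ Ioc M n := (mem_filter.1 (hS ▸ (mem_Ico.2 ⟨le_rfl, hlt⟩) : p ∈ {a ∈ Ioc M n | goodm X a h m})).1
          have hq : q - 1 ∈ Ioc M n := (mem_filter.1 (hS ▸ (mem_Ico.2 ⟨by omega, by omega⟩) : q - 1 ∈ {a ∈ Ioc M n | goodm X a h m})).1
          rw [mem_Ioc] at hp hq
          exact osc_sum X n h m p q hh (by omega) (by omega) hpq (by omega) hn1 hX hnX hhX
      have := fc_bound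
      calc _ ≤ (4 / √h * 3) * (480 * √h * √X) := by gcongr
        _ = _ := by field_simp; norm_num
    refine (norm_sum_le _ _).trans ((sum_le_sum hm).trans ?_)
    rw [sum_const, card_range, nsmul_eq_mul]
    push_cast
    nlinarith [mul_le_mul_of_nonneg_right hh' (Real.sqrt_nonneg X)]
  have h3 : ‖∑ a ∈ Ioc M n, (∑ b ∈ Fs X a, ee (h * ((X + (b:ℝ)^2/4) / a)) - ee (h * (X / a)) * A a)‖ ≤ n * (530 * h + 24 * √n / √h) := by
    refine (norm_sum_le _ _).trans ((sum_le_sum h1).trans ?_)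
    rw [sum_const, nsmul_eq_mul, Nat.card_Ioc]
    gcongr
    omega
  rw [sum_sub_distrib] at h3
  have h4 := norm_add_le (∑ a ∈ Ioc M n, ∑ b ∈ Fs X a, ee (h * ((X + (b:ℝ)^2/4) / a)) - ∑ a ∈ Ioc M n, ee (h * (X / a)) * A a) (∑ a ∈ Ioc M n, ee (h * (X / a)) * A a)
  rw [sub_add_cancel] at h4
  have e : 24 * (n * √(n:ℝ)) / √h = n * (24 * √n / √h) := by ring
  rw [e]
  nlinarith [mul_le_mul_of_nonneg_right hnsX (by positivity : 0 ≤ (h:ℝ)), mul_nonneg (by positivity : 0 ≤ (h:ℝ)) (Real.sqrt_nonneg X)]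

lemma sum_three_halves (N : ℕ) : ∑ h ∈ Ico 1 (N+2), 1 / ((h:ℝ) * √h) ≤ 3 - 2 / √((N:ℝ)+1) := by
  induction N with
  | zero => simp; norm_num
  | succ N ih =>
    rw [sum_Ico_succ_top (by omega)]
    have hs : 0 < √((N:ℝ)+1) := Real.sqrt_pos.2 (by positivity)
    have ht : 0 < √((N:ℝ)+1+1) := Real.sqrt_pos.2 (by positivity)
    have hss : √((N:ℝ)+1)^2 = N + 1 := Real.sq_sqrt (by positivity)
    have htt : √((N:ℝ)+1+1)^2 = N + 1 + 1 := Real.sq_sqrt (by positivity)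
    push_cast
    rw [show (N:ℝ) + 2 = N + 1 + 1 by ring]
    set s := √((N:ℝ)+1)
    set t := √((N:ℝ)+1+1)
    have hst : s ≤ t := Real.sqrt_le_sqrt (by linarith)
    have key : 1 / (((N:ℝ)+1+1) * t) ≤ 2 / s - 2 / t := by
      have e : 2 / s - 2 / t = 2 / (s * t * (s + t)) := by
        have : (t - s) * (s + t) = 1 := by nlinarith
        field_simp
        linarith
      rw [e, ← htt, div_le_div_iff₀ (by positivity) (by positivity)]
      nlinarith [mul_pos hs ht, mul_nonneg (mul_pos hs ht).le hs.le, mul_nonneg ht.le (sub_nonneg.2 hst), mul_nonneg (mul_pos ht ht).le (sub_nonneg.2 hst), mul_nonneg (mul_pos hs ht).le (sub_nonneg.2 hst)]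
    linarith

lemma sum_three_halves2 (H : ℕ) : ∑ h ∈ Ico 1 H, 1 / ((h:ℝ) * √h) ≤ 3 := by
  rcases Nat.lt_or_ge H 2 with h | h
  · rw [Ico_eq_empty (by omega)]; simp
  · obtain ⟨N, rfl⟩ := Nat.exists_eq_add_of_le' h
    have := sum_three_halves N
    have : 0 ≤ 2 / √((N:ℝ)+1) := by positivity
    linarith

lemma Fs_card (X : ℝ) (a : ℕ) : #(Fs X a) ≤ a := by
  unfold Fs
  refine (card_filter_le _ _).trans ?_
  simp

lemma block (Y : ℝ) (hY : 1 ≤ Y) (n M : ℕ) (hM : n ≤ 2 * M + 1) (hn1 : (n:ℝ)^2 ≤ 4 * Y^4) (hn2 : Y^3 ≤ (n:ℝ)^2) :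
    |∑ a ∈ Ioc M n, ∑ b ∈ Fs (Y^4) a, psi ((Y^4 + (b:ℝ)^2/4) / a)| ≤ 13200 * n * Y := by
  have hY0 : 0 < Y := by linarith
  have hnY : Y ≤ n := by
    apply le_of_sq_le_sq _ (by positivity)
    nlinarith [sq_nonneg Y]
  have hn' : (1:ℝ) ≤ n := by linarith
  have hnN : 1 ≤ n := by exact_mod_cast hn'
  set H := ⌈(n:ℝ) / Y⌉₊ with hH
  have hH1 : 1 ≤ H := by
    rw [hH, Nat.one_le_ceil_iff]; positivity
  have hHr : (n:ℝ) / Y ≤ H := Nat.le_ceil _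
  have hHr2 : (H:ℝ) < n / Y + 1 := Nat.ceil_lt_add_one (by positivity)
  have hsq : √(Y^4) = Y^2 := by
    rw [show Y^4 = (Y^2)^2 by ring]; exact Real.sqrt_sq (by positivity)
  have hfe := fejer ((Ioc M n).sigma fun a => Fs (Y^4) a) (fun i => (Y^4 + (i.2:ℝ)^2/4) / i.1) H hH1
  rw [sum_sigma] at hfe
  simp only at hfe
  refine hfe.trans ?_
  have hcard : ((#((Ioc M n).sigma fun a => Fs (Y^4) a) : ℕ) : ℝ) ≤ n * n := by
    rw [card_sigma]
    have : ∑ a ∈ Ioc M n, #(Fs (Y^4) a) ≤ ∑ a ∈ Ioc M n, n := sum_le_sum fun a ha => (Fs_card _ _).trans (mem_Ioc.1 ha).2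
    have h2 : ∑ a ∈ Ioc M n, n ≤ n * n := by
      rw [sum_const, Nat.card_Ioc, smul_eq_mul]
      exact Nat.mul_le_mul_right _ (by omega)
    exact_mod_cast this.trans h2
  have hHpos : (0:ℝ) < H := by exact_mod_cast hH1
  have t1 : 32 * ((#((Ioc M n).sigma fun a => Fs (Y^4) a) : ℕ) : ℝ) / H ≤ 32 * n * Y := by
    rw [div_le_iff₀ hHpos]
    have : (n:ℝ) ≤ H * Y := by rwa [div_le_iff₀ hY0] at hHr
    nlinarith
  have t2 : ∀ h ∈ Ico 1 H, (1 / (h:ℝ)) * ‖∑ i ∈ (Ioc M n).sigma fun a => Fs (Y^4) a, ee (h * ((Y^4 + (i.2:ℝ)^2/4) / i.1))‖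
      ≤ 13000 * Y^2 + 24 * (n * √n) * (1 / ((h:ℝ) * √h)) := by
    intro h hh
    rw [mem_Ico] at hh
    have hh1 : (1:ℝ) ≤ h := by exact_mod_cast hh.1
    have hhH : (h:ℝ) < n / Y := by
      have := hh.2
      rwa [hH, Nat.lt_ceil] at this
    rw [lt_div_iff₀ hY0] at hhH
    rw [sum_sigma]
    have hb := S_bound (Y^4) n M h hh.1 hM hnN (by positivity) (by
      have : (h:ℝ) ≤ n := by nlinarith
      have : h ≤ n := by exact_mod_cast this
      omega) hn1 (by
        calc (h:ℝ) * Y^4 = h * Y * Y^3 := by ring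
          _ ≤ (n:ℝ) * (n:ℝ)^2 := by gcongr
          _ ≤ 2 * (n:ℝ)^3 := by nlinarith [pow_pos (by linarith : (0:ℝ) < n) 3])
    rw [hsq] at hb
    have hsh : 0 < √(h:ℝ) := Real.sqrt_pos.2 (by linarith)
    calc _ ≤ (1 / (h:ℝ)) * (13000 * h * Y^2 + 24 * (n * √n) / √h) := by gcongr
      _ = _ := by field_simp
  have t3 := sum_le_sum t2
  rw [sum_add_distrib, sum_const, nsmul_eq_mul, Nat.card_Ico] at t3
  have t4 := sum_three_halves2 H
  have t5 : ((H - 1 : ℕ) : ℝ) * (13000 * Y^2) ≤ 13000 * n * Y := by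
    have : ((H - 1 : ℕ) : ℝ) ≤ n / Y := by rw [Nat.cast_sub hH1]; push_cast; linarith
    calc _ ≤ n / Y * (13000 * Y^2) := by gcongr
      _ = _ := by field_simp
  have t6 : √(n:ℝ) ≤ 2 * Y := by
    rw [Real.sqrt_le_left (by positivity)]
    have : (n:ℝ) ≤ 2 * Y^2 := by
      apply le_of_sq_le_sq _ (by positivity)
      nlinarith
    nlinarith
  have t7 : 24 * (n * √(n:ℝ)) * ∑ h ∈ Ico 1 H, 1 / ((h:ℝ) * √h) ≤ 24 * (n * (2 * Y)) * 3 := by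
    gcongr
  rw [mul_sum] at t7
  have t8 : 0 ≤ (n:ℝ) * Y := by positivity
  linarith

lemma psi_total (Y : ℝ) (hY : 1 ≤ Y) (n : ℕ) (hn1 : (n:ℝ)^2 ≤ 4 * Y^4) :
    |∑ a ∈ Ioc 0 n, ∑ b ∈ Fs (Y^4) a, psi ((Y^4 + (b:ℝ)^2/4) / a)| ≤ 26400 * n * Y + Y^3 := by
  induction n using Nat.strong_induction_on with
  | _ n ih =>
  rcases lt_or_ge ((n:ℝ)^2) (Y^3) with hlt | hge
  · have : |∑ a ∈ Ioc 0 n, ∑ b ∈ Fs (Y^4) a, psi ((Y^4 + (b:ℝ)^2/4) / a)| ≤ ∑ a ∈ Ioc 0 n, (n:ℝ) := by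
      refine (abs_sum_le_sum_abs _ _).trans (sum_le_sum fun a ha => ?_)
      refine (abs_sum_le_sum_abs _ _).trans ?_
      calc _ ≤ ∑ b ∈ Fs (Y^4) a, (1:ℝ) := sum_le_sum fun b _ => by linarith [psi_abs ((Y^4 + (b:ℝ)^2/4) / a)]
        _ = (#(Fs (Y^4) a) : ℝ) := by simp
        _ ≤ n := by exact_mod_cast (Fs_card _ _).trans (mem_Ioc.1 ha).2
    simp only [sum_const, Nat.card_Ioc, nsmul_eq_mul] at this
    have h2 : 0 ≤ 26400 * (n:ℝ) * Y := by positivity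
    simp only [Nat.sub_zero] at this
    nlinarith
  · have hn0 : 0 < n := by
      rcases Nat.eq_zero_or_pos n with rfl | h
      · have : (1:ℝ) ≤ Y^3 := one_le_pow₀ hY
        simp at hge; linarith
      · exact h
    have hb := block Y hY n (n/2) (by omega) hn1 hge
    have hle : (((n/2 : ℕ)):ℝ) ≤ n / 2 := Nat.cast_div_le
    have hi := ih (n/2) (by omega) (by
      refine le_trans ?_ hn1
      have : ((n/2 : ℕ):ℝ) ≤ n := by exact_mod_cast Nat.div_le_self n 2
      gcongr)
    have hun : Ioc 0 n = Ioc 0 (n/2) ∪ Ioc (n/2) n := by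
      ext x; simp only [mem_union, mem_Ioc]; omega
    rw [hun, sum_union (by
      rw [disjoint_left]; intro x; simp only [mem_Ioc]; omega)]
    refine (abs_add_le _ _).trans ?_
    nlinarith

/-- The positive part of the number of admissible third coordinates. -/
noncomputable def phi (X : ℝ) (a : ℕ) (u : ℝ) : ℝ := max 0 ((X + u^2/4) / a - a)

lemma phi_continuous (X : ℝ) (a : ℕ) : Continuous (phi X a) := by
  unfold phi
  apply continuous_const.max
  exact ((by fun_prop : Continuous fun u : ℝ => X + u^2/4).div_const _).sub continuous_const

lemma trap_err (X : ℝ) (a : ℕ) (ha : 1 ≤ a) :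
    |∑ b ∈ range a, (phi X a b + phi X a ((b + 1 : ℕ) : ℝ)) / 2 - ∫ u in (0:ℝ)..a, phi X a u| ≤ 1/2 := by
  classical
  have ha' : (0:ℝ) < a := by exact_mod_cast ha
  have hc := phi_continuous X a
  set s : ℕ → ℝ := fun b => if 4 * (a:ℝ)^2 ≤ 4 * X + (b:ℝ)^2 then (b:ℝ) / (2 * a) else 0 with hs
  have hadj := intervalIntegral.sum_integral_adjacent_intervals (f := phi X a) (μ := MeasureTheory.volume) (a := fun k : ℕ => (k:ℝ)) (n := a)
    (fun k _ => hc.intervalIntegrable _ _)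
  simp only [Nat.cast_zero] at hadj
  rw [← hadj, ← sum_sub_distrib]
  have hval : ∀ u : ℝ, 4 * (a:ℝ)^2 ≤ 4 * X + u^2 → phi X a u = (X + u^2/4) / a - a := by
    intro u hu
    unfold phi
    rw [max_eq_right]
    rw [sub_nonneg, le_div_iff₀ ha']; nlinarith
  have hval0 : ∀ u : ℝ, 4 * X + u^2 ≤ 4 * (a:ℝ)^2 → phi X a u = 0 := by
    intro u hu
    unfold phi
    rw [max_eq_left]
    rw [sub_nonpos, div_le_iff₀ ha']; nlinarith
  have hterm : ∀ b ∈ range a, |(phi X a b + phi X a ((b + 1 : ℕ) : ℝ)) / 2 - ∫ u in (b:ℝ)..((b + 1 : ℕ) : ℝ), phi X a u| ≤ s (b+1) - s b := by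
    intro b _
    have hbb : (b:ℝ) ≤ ((b + 1 : ℕ) : ℝ) := by push_cast; linarith
    have hb0 : (0:ℝ) ≤ b := by positivity
    by_cases h1 : 4 * (a:ℝ)^2 ≤ 4 * X + (b:ℝ)^2
    · have h2 : 4 * (a:ℝ)^2 ≤ 4 * X + ((b + 1 : ℕ) : ℝ)^2 := by push_cast; nlinarith
      have hI : ∫ u in (b:ℝ)..((b + 1 : ℕ) : ℝ), phi X a u = ∫ u in (b:ℝ)..((b + 1 : ℕ) : ℝ), ((X / a - a) + (1 / (4 * a)) * u^2) := by
        apply intervalIntegral.integral_congr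
        intro u hu
        rw [Set.uIcc_of_le hbb] at hu
        simp only
        rw [hval u (by nlinarith [hu.1])]
        field_simp
        ring
      rw [hI, intervalIntegral.integral_add (by simp) ((by fun_prop : Continuous fun u : ℝ => (1 / (4 * (a:ℝ))) * u^2).intervalIntegrable _ _),
        intervalIntegral.integral_const_mul, integral_pow, intervalIntegral.integral_const, hval _ h1, hval _ h2]
      simp only [hs, if_pos h1, if_pos h2]
      push_cast
      have e : ((X + (b:ℝ)^2/4) / a - a + ((X + ((b:ℝ)+1)^2/4) / a - a)) / 2 - (((b:ℝ) + 1 - b) • (X / a - a) + 1 / (4 * a) * ((((b:ℝ)+1)^(2+1) - (b:ℝ)^(2+1)) / (2 + 1))) = 1 / (24 * a) := by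
        simp only [smul_eq_mul]
        field_simp
        ring
      have e2 : ((b:ℝ) + 1) / (2 * a) - b / (2 * a) = 1 / (2 * a) := by ring
      rw [e, e2, abs_of_pos (by positivity)]
      apply one_div_le_one_div_of_le (by positivity)
      linarith
    · rw [not_le] at h1
      have hp1 := hval0 _ h1.le
      simp only [hs, if_neg (not_le.2 h1)]
      rw [hp1, zero_add, sub_zero]
      by_cases h2 : 4 * (a:ℝ)^2 ≤ 4 * X + ((b + 1 : ℕ) : ℝ)^2
      · rw [if_pos h2]
        have hv2 := hval _ h2
        have hpos : 0 ≤ phi X a ((b + 1 : ℕ) : ℝ) := by unfold phi; exact le_max_left _ _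
        have hbd : phi X a ((b + 1 : ℕ) : ℝ) ≤ ((b + 1 : ℕ) : ℝ) / (2 * a) := by
          rw [hv2, sub_le_iff_le_add, div_le_iff₀ ha']
          push_cast
          have : (((b:ℝ) + 1) / (2 * a) + a) * a = ((b:ℝ)+1)/2 + a^2 := by field_simp
          rw [this]
          nlinarith
        have hI0 : 0 ≤ ∫ u in (b:ℝ)..((b + 1 : ℕ) : ℝ), phi X a u :=
          intervalIntegral.integral_nonneg hbb fun u _ => by unfold phi; exact le_max_left _ _
        have hI1 : ∫ u in (b:ℝ)..((b + 1 : ℕ) : ℝ), phi X a u ≤ phi X a ((b + 1 : ℕ) : ℝ) := by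
          have := intervalIntegral.integral_mono_on hbb (hc.intervalIntegrable _ _) (intervalIntegrable_const (c := phi X a ((b + 1 : ℕ) : ℝ))) (μ := MeasureTheory.volume) (fun u hu => by
            unfold phi
            have : u^2 ≤ ((b + 1 : ℕ) : ℝ)^2 := by
              apply pow_le_pow_left₀ (by linarith [hu.1]) hu.2
            gcongr)
          rw [intervalIntegral.integral_const] at this
          simpa using this
        rw [abs_le]
        constructor <;> linarith
      · rw [if_neg h2]
        rw [not_le] at h2
        rw [hval0 _ h2.le]
        have hI : ∫ u in (b:ℝ)..((b + 1 : ℕ) : ℝ), phi X a u = ∫ u in (b:ℝ)..((b + 1 : ℕ) : ℝ), (0:ℝ) := by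
          apply intervalIntegral.integral_congr
          intro u hu
          rw [Set.uIcc_of_le hbb] at hu
          simp only
          apply hval0
          have : u^2 ≤ ((b + 1 : ℕ) : ℝ)^2 := by
            apply pow_le_pow_left₀ (by linarith [hu.1]) hu.2
          linarith
        rw [hI]; simp
  refine (abs_sum_le_sum_abs _ _).trans ((sum_le_sum hterm).trans ?_)
  rw [sum_range_sub]
  have h0 : s 0 = 0 := by simp [hs]
  have h1 : s a ≤ 1/2 := by
    simp only [hs]
    split_ifs
    · apply le_of_eq; field_simp
    · norm_num
  linarith

lemma phi_subst (X : ℝ) (a : ℕ) (ha : 1 ≤ a) :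
    ∫ u in (0:ℝ)..a, phi X a u = ∫ s in (0:ℝ)..1, max 0 (X - (1 - s^2/4) * (a:ℝ)^2) := by
  have ha' : (0:ℝ) < a := by exact_mod_cast ha
  have h := intervalIntegral.mul_integral_comp_mul_left (a := 0) (b := 1) (f := phi X a) (c := (a:ℝ))
  rw [mul_zero, mul_one] at h
  rw [← h, ← intervalIntegral.integral_const_mul]
  apply intervalIntegral.integral_congr
  intro s _
  simp only [phi]
  rw [mul_max_of_nonneg _ _ ha'.le, mul_zero]
  congr 1
  field_simp
  ring

lemma sum_sq_id (n : ℕ) : ∑ a ∈ Ioc 0 n, (a:ℝ)^2 = (n:ℝ)^3/3 + (n:ℝ)^2/2 + n/6 := by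
  induction n with
  | zero => simp
  | succ n ih =>
    rw [sum_Ioc_succ_top (Nat.zero_le n), ih]
    push_cast; ring

lemma sum_para (R : ℝ) (hR : 0 ≤ R) (L : ℕ) (hL : R < L + 1) :
    |∑ a ∈ Ioc 0 L, max 0 (R^2 - (a:ℝ)^2) - (2 * R^3/3 - R^2/2)| ≤ 2 * R := by
  set n := ⌊R⌋₊ with hn
  have hnR : (n:ℝ) ≤ R := Nat.floor_le hR
  have hRn : R < n + 1 := Nat.lt_floor_add_one R
  have hnL : n ≤ L := by
    have : (n:ℝ) < L + 1 := by linarith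
    have : n < L + 1 := by exact_mod_cast this
    omega
  have h1 : ∑ a ∈ Ioc 0 L, max 0 (R^2 - (a:ℝ)^2) = ∑ a ∈ Ioc 0 n, (R^2 - (a:ℝ)^2) := by
    symm
    have hsub : Ioc 0 n ⊆ Ioc 0 L := Ioc_subset_Ioc le_rfl hnL
    rw [← sum_subset hsub]
    · apply sum_congr rfl
      intro a ha
      rw [max_eq_right]
      have : (a:ℝ) ≤ n := by exact_mod_cast (mem_Ioc.1 ha).2
      have ha0 : (0:ℝ) ≤ a := by positivity
      nlinarith
    · intro a ha hna
      rw [mem_Ioc] at ha hna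
      rw [max_eq_left]
      have : (n:ℝ) + 1 ≤ a := by exact_mod_cast (by omega : n + 1 ≤ a)
      nlinarith
  rw [h1, sum_sub_distrib, sum_const, Nat.card_Ioc, nsmul_eq_mul, sum_sq_id, Nat.sub_zero]
  have hn0 : (0:ℝ) ≤ n := by positivity
  have e : (n:ℝ) * R^2 - ((n:ℝ)^3/3 + (n:ℝ)^2/2 + n/6) - (2 * R^3/3 - R^2/2)
      = -((R - n)^2 * (2 * R + n) / 3) + (R - n) * (R + n) / 2 - n / 6 := by ring
  have hd0 : 0 ≤ R - n := by linarith
  have hd1 : R - n ≤ 1 := by linarith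
  have k1 : (R - n)^2 * (2 * R + n) ≤ 1 * (3 * R) := by
    apply mul_le_mul (by nlinarith) (by linarith) (by linarith) (by norm_num)
  have k2 : 0 ≤ (R - n)^2 * (2 * R + n) := by positivity
  have k3 : (R - n) * (R + n) ≤ 1 * (2 * R) := by
    apply mul_le_mul hd1 (by linarith) (by linarith) (by norm_num)
  have k4 : 0 ≤ (R - n) * (R + n) := by positivity
  rw [e, abs_le]
  constructor <;> linarith

lemma int_arcsin : ∫ s in (0:ℝ)..1, 1 / √(1 - s^2/4) = Real.pi / 3 := by
  have hd : ∀ s ∈ Set.uIcc (0:ℝ) 1, HasDerivAt (fun s : ℝ => 2 * Real.arcsin (s / 2)) (1 / √(1 - s^2/4)) s := by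
    intro s hs
    rw [Set.uIcc_of_le zero_le_one] at hs
    have h1 := (Real.hasDerivAt_arcsin (x := s / 2) (by linarith [hs.1]) (by linarith [hs.2])).comp s ((hasDerivAt_id s).div_const 2)
    refine (h1.const_mul 2).congr_deriv ?_
    rw [show (s/2)^2 = s^2/4 by ring]
    ring
  have hcont : ContinuousOn (fun s : ℝ => 1 / √(1 - s^2/4)) (Set.uIcc (0:ℝ) 1) := by
    apply ContinuousOn.div continuousOn_const (by fun_prop)
    intro s hs
    rw [Set.uIcc_of_le zero_le_one] at hs
    apply (Real.sqrt_pos.2 _).ne'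
    nlinarith [hs.1, hs.2]
  rw [intervalIntegral.integral_eq_sub_of_hasDerivAt hd hcont.intervalIntegrable]
  have h6 : Real.arcsin (1/2) = Real.pi / 6 := by
    rw [← Real.sin_pi_div_six, Real.arcsin_sin] <;> linarith [Real.pi_pos]
  rw [h6]
  simp
  ring

lemma main_term (X : ℝ) (hX : 0 < X) (L : ℕ) (hL : 2 * √X < L + 1) :
    |(∑ a ∈ Ioc 0 L, ∫ u in (0:ℝ)..a, phi X a u) - (2 * Real.pi / 9 * (X * √X) - X / 2)| ≤ 2 * √X := by
  have hsX : 0 < √X := Real.sqrt_pos.2 hX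
  have hsq : √X ^ 2 = X := Real.sq_sqrt hX.le
  rw [sum_congr rfl (fun a ha => phi_subst X a (mem_Ioc.1 ha).1)]
  rw [← intervalIntegral.integral_finsetSum (fun (a : ℕ) _ => (by fun_prop : Continuous fun s : ℝ => max 0 (X - (1 - s^2/4) * (a:ℝ)^2)).intervalIntegrable _ _)]
  have hcont : ContinuousOn (fun s : ℝ => 1 / √(1 - s^2/4)) (Set.uIcc (0:ℝ) 1) := by
    apply ContinuousOn.div continuousOn_const (by fun_prop)
    intro s hs
    rw [Set.uIcc_of_le zero_le_one] at hs
    apply (Real.sqrt_pos.2 _).ne'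
    nlinarith [hs.1, hs.2]
  have hI : 2 * Real.pi / 9 * (X * √X) - X / 2 = ∫ s in (0:ℝ)..1, (2/3 * (X * √X) * (1 / √(1 - s^2/4)) - X / 2) := by
    rw [intervalIntegral.integral_sub (hcont.intervalIntegrable.const_mul _) intervalIntegrable_const, intervalIntegral.integral_const_mul, int_arcsin]
    simp
    ring
  rw [hI, ← intervalIntegral.integral_sub]
  · have hb := intervalIntegral.norm_integral_le_of_norm_le_const (a := 0) (b := 1) (C := 2 * √X)
      (f := fun s : ℝ => ∑ a ∈ Ioc 0 L, max 0 (X - (1 - s^2/4) * (a:ℝ)^2) - (2/3 * (X * √X) * (1 / √(1 - s^2/4)) - X / 2)) (by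
      intro s hs
      rw [Set.uIoc_of_le zero_le_one] at hs
      have hq0 : 3/4 ≤ 1 - s^2/4 := by nlinarith [hs.1, hs.2]
      have hq1 : 1 - s^2/4 ≤ 1 := by nlinarith
      set q := 1 - s^2/4
      have hsq0 : 0 < √q := Real.sqrt_pos.2 (by linarith)
      have hqq : √q^2 = q := Real.sq_sqrt (by linarith)
      have hsq1 : √q ≤ 1 := by nlinarith
      have hsqh : 1/2 ≤ √q := by nlinarith
      set R := √X / √q with hR
      have hRq : q * R^2 = X := by
        rw [hR, div_pow, hqq, hsq]; field_simp
      have hR0 : 0 ≤ R := by positivity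
      have hRL : R < L + 1 := by
        refine lt_of_le_of_lt ?_ hL
        rw [hR, div_le_iff₀ hsq0]
        nlinarith
      have hp := sum_para R hR0 L hRL
      have e1 : ∑ a ∈ Ioc 0 L, max 0 (X - q * (a:ℝ)^2) = q * ∑ a ∈ Ioc 0 L, max 0 (R^2 - (a:ℝ)^2) := by
        rw [mul_sum]
        apply sum_congr rfl; intro a _
        rw [mul_max_of_nonneg _ _ (by linarith), mul_zero, mul_sub, hRq]
      have e2 : 2/3 * (X * √X) * (1 / √q) - X / 2 = q * (2 * R^3/3 - R^2/2) := by
        have : √X * (1 / √q) = R := by rw [hR]; ring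
        calc _ = 2/3 * X * (√X * (1 / √q)) - X / 2 := by ring
          _ = 2/3 * (q * R^2) * R - (q * R^2) / 2 := by rw [this, hRq]
          _ = _ := by ring
      have e3 : q * R = √q * √X := by
        rw [hR, ← hqq]; field_simp
        rw [Real.sqrt_sq hsq0.le]
      rw [e1, e2, ← mul_sub, norm_mul, Real.norm_eq_abs, Real.norm_eq_abs, abs_of_pos (by linarith)]
      calc _ ≤ q * (2 * R) := by
            apply mul_le_mul_of_nonneg_left hp (by linarith)
        _ = 2 * (√q * √X) := by rw [← e3]; ring
        _ ≤ 2 * √X := by nlinarith)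
    rw [Real.norm_eq_abs] at hb
    simpa using hb
  · exact (by fun_prop : Continuous fun s : ℝ => ∑ a ∈ Ioc 0 L, max 0 (X - (1 - s^2/4) * (a:ℝ)^2)).intervalIntegrable _ _
  · exact (hcont.intervalIntegrable.const_mul _).sub intervalIntegrable_const

lemma count_eq (X : ℝ) (hX : 0 < X) (L : ℕ) (hL : 2 * √X < L + 1) :
    Ncount X = ∑ a ∈ Ioc 0 L, (∑ b ∈ range (a+1), (⌊(X + (b:ℝ)^2/4) / a⌋₊ + 1 - a) + ∑ b ∈ Ico 1 a, (⌊(X + (b:ℝ)^2/4) / a⌋₊ - a)) := by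
  classical
  set P1 : Finset (Σ _ : ℕ, Σ _ : ℕ, ℕ) := (Ioc 0 L).sigma fun a => (range (a+1)).sigma fun b => Icc a ⌊(X + (b:ℝ)^2/4) / a⌋₊ with hP1
  set P2 : Finset (Σ _ : ℕ, Σ _ : ℕ, ℕ) := (Ioc 0 L).sigma fun a => (Ico 1 a).sigma fun b => Ioc a ⌊(X + (b:ℝ)^2/4) / a⌋₊ with hP2
  set f1 : (Σ _ : ℕ, Σ _ : ℕ, ℕ) → ℤ × ℤ × ℤ := fun t => ((t.1:ℤ), (t.2.1:ℤ), (t.2.2:ℤ)) with hf1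
  set f2 : (Σ _ : ℕ, Σ _ : ℕ, ℕ) → ℤ × ℤ × ℤ := fun t => ((t.1:ℤ), -(t.2.1:ℤ), (t.2.2:ℤ)) with hf2
  have hi1 : Function.Injective f1 := by
    rintro ⟨a, b, c⟩ ⟨a', b', c'⟩ h
    simp only [hf1, Prod.mk.injEq, Nat.cast_inj] at h
    obtain ⟨rfl, rfl, rfl⟩ := h; rfl
  have hi2 : Function.Injective f2 := by
    rintro ⟨a, b, c⟩ ⟨a', b', c'⟩ h
    simp only [hf2, Prod.mk.injEq, Nat.cast_inj, neg_inj] at h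
    obtain ⟨rfl, rfl, rfl⟩ := h; rfl
  -- bound on `a`
  have hbound : ∀ a b c : ℕ, b ≤ a → a ≤ c → (a:ℝ) * c - (b:ℝ)^2/4 ≤ X → a ≤ L := by
    intro a b c hba hac hd
    have h1 : (b:ℝ) ≤ a := by exact_mod_cast hba
    have h2 : (a:ℝ) ≤ c := by exact_mod_cast hac
    have h0 : (0:ℝ) ≤ a := by positivity
    have hb0 : (0:ℝ) ≤ b := by positivity
    have h3 : (a:ℝ)^2 ≤ (2 * √X)^2 := by
      rw [mul_pow, Real.sq_sqrt hX.le]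
      nlinarith
    have h4 : (a:ℝ) ≤ 2 * √X := le_of_sq_le_sq h3 (by positivity)
    have : (a:ℝ) < L + 1 := by linarith
    have : a < L + 1 := by exact_mod_cast this
    omega
  have hdet : ∀ a b c : ℕ, 0 < a → (c ≤ ⌊(X + (b:ℝ)^2/4) / a⌋₊ ↔ (a:ℝ) * c - (b:ℝ)^2/4 ≤ X) := by
    intro a b c ha
    have ha' : (0:ℝ) < a := by exact_mod_cast ha
    rw [Nat.le_floor_iff (by positivity), le_div_iff₀ ha']
    constructor <;> intro h <;> linarith
  have hpos : ∀ a b c : ℕ, 0 < a → b ≤ a → a ≤ c → b^2 < 4 * a * c := by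
    intro a b c ha hb hc
    nlinarith [Nat.mul_le_mul hb hb, Nat.mul_le_mul_left a hc, Nat.mul_pos ha ha]
  have hset : {p : ℤ × ℤ × ℤ | IsReducedTriple p.1 p.2.1 p.2.2 ∧ detTriple p.1 p.2.1 p.2.2 ≤ X}
      = ((P1.image f1 ∪ P2.image f2 : Finset (ℤ × ℤ × ℤ)) : Set (ℤ × ℤ × ℤ)) := by
    ext ⟨a, b, c⟩
    simp only [Set.mem_setOf_eq, coe_union, coe_image, Set.mem_union, Set.mem_image, mem_coe]
    constructor
    · rintro ⟨⟨h1, h2, h3, h4, h5⟩, h6⟩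
      unfold detTriple at h6
      obtain ⟨a, rfl⟩ := Int.eq_ofNat_of_zero_le h1.le
      obtain ⟨c, rfl⟩ := Int.eq_ofNat_of_zero_le (h1.le.trans h4)
      have ha : 0 < a := by exact_mod_cast h1
      have hac : a ≤ c := by exact_mod_cast h4
      rcases le_or_gt 0 b with hb | hb
      · left
        obtain ⟨b, rfl⟩ := Int.eq_ofNat_of_zero_le hb
        have hba : b ≤ a := by
          rw [abs_of_nonneg hb] at h3; exact_mod_cast h3
        push_cast at h6
        refine ⟨⟨a, b, c⟩, ?_, rfl⟩
        simp only [hP1, mem_sigma, mem_Ioc, mem_range, mem_Icc]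
        exact ⟨⟨ha, hbound a b c hba hac h6⟩, by omega, hac, (hdet a b c ha).2 h6⟩
      · right
        obtain ⟨k, hk⟩ := Int.eq_ofNat_of_zero_le (by omega : 0 ≤ -b)
        obtain rfl : b = -(k:ℤ) := by omega
        have hne : ¬ (|(-(k:ℤ))| = (a:ℤ) ∨ (a:ℤ) = c) := fun h => by have := h5 h; omega
        rw [abs_neg, Nat.abs_cast] at h3 hne
        push Not at hne
        have h6' : (a:ℝ) * c - (k:ℝ)^2/4 ≤ X := by
          push_cast at h6; rw [neg_sq] at h6; exact h6
        refine ⟨⟨a, k, c⟩, ?_, rfl⟩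
        simp only [hP2, mem_sigma, mem_Ioc, mem_Ico]
        refine ⟨⟨ha, hbound a k c (by omega) hac h6'⟩, by omega, by omega, (hdet a k c ha).2 h6'⟩
    · rintro (⟨⟨a', b', c'⟩, ht, he⟩ | ⟨⟨a', b', c'⟩, ht, he⟩)
      · simp only [hP1, mem_sigma, mem_Ioc, mem_range, mem_Icc] at ht
        simp only [hf1, Prod.mk.injEq] at he
        obtain ⟨rfl, rfl, rfl⟩ := he
        obtain ⟨⟨h1, h2⟩, h3, h4, h5⟩ := ht
        refine ⟨⟨by exact_mod_cast h1, by exact_mod_cast hpos a' b' c' h1 (by omega) h4, ?_, by exact_mod_cast h4, fun _ => by simp⟩, ?_⟩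
        · simp only [Nat.abs_cast]; omega
        · unfold detTriple; push_cast; exact (hdet a' b' c' h1).1 h5
      · simp only [hP2, mem_sigma, mem_Ioc, mem_Ico] at ht
        simp only [hf2, Prod.mk.injEq] at he
        obtain ⟨rfl, rfl, rfl⟩ := he
        obtain ⟨⟨h1, h2⟩, h3, h4, h5⟩ := ht
        refine ⟨⟨by exact_mod_cast h1, ?_, ?_, by omega, fun h => ?_⟩, ?_⟩
        · simp only [neg_sq]
          exact_mod_cast hpos a' b' c' h1 (by omega) h4.le
        · simp only [abs_neg, Nat.abs_cast]; omega
        · simp only [abs_neg, Nat.abs_cast] at h; omega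
        · unfold detTriple; push_cast; rw [neg_sq]; exact (hdet a' b' c' h1).1 h5
  have hdisj : Disjoint (P1.image f1) (P2.image f2) := by
    rw [disjoint_left]
    intro x hx hy
    rw [mem_image] at hx hy
    obtain ⟨s, hs, rfl⟩ := hx
    obtain ⟨t, ht, he⟩ := hy
    simp only [hf1, hf2, Prod.mk.injEq] at he
    rw [hP2, mem_sigma, mem_sigma, mem_Ico] at ht
    omega
  unfold Ncount
  rw [hset, Set.ncard_coe_finset, card_union_of_disjoint hdisj, card_image_of_injective _ hi1, card_image_of_injective _ hi2,
    hP1, hP2, card_sigma, card_sigma, ← sum_add_distrib]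
  apply sum_congr rfl
  intro a _
  simp only [card_sigma, Nat.card_Icc, Nat.card_Ioc]

lemma floor1 (X : ℝ) (hX : 0 < X) (a b : ℕ) (ha : 1 ≤ a) :
    ((⌊(X + (b:ℝ)^2/4) / a⌋₊ + 1 - a : ℕ) : ℝ) = phi X a b + (if 4 * (a:ℝ)^2 ≤ 4 * X + (b:ℝ)^2 then -psi ((X + (b:ℝ)^2/4) / a) + 1/2 else 0) ∧
    ((⌊(X + (b:ℝ)^2/4) / a⌋₊ - a : ℕ) : ℝ) = phi X a b + (if 4 * (a:ℝ)^2 ≤ 4 * X + (b:ℝ)^2 then -psi ((X + (b:ℝ)^2/4) / a) - 1/2 else 0) := by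
  have ha' : (0:ℝ) < a := by exact_mod_cast ha
  have hg0 : 0 ≤ (X + (b:ℝ)^2/4) / a := by positivity
  have hiff : 4 * (a:ℝ)^2 ≤ 4 * X + (b:ℝ)^2 ↔ (a:ℝ) ≤ (X + (b:ℝ)^2/4) / a := by
    rw [le_div_iff₀ ha']; constructor <;> intro h <;> nlinarith
  simp only [hiff]
  unfold phi
  generalize (X + (b:ℝ)^2/4) / a = g at *
  split_ifs with h
  · have h1 : a ≤ ⌊g⌋₊ := (Nat.le_floor_iff hg0).2 h
    have h2 : (⌊g⌋₊ : ℝ) = g - Int.fract g := by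
      have := natCast_floor_eq_intCast_floor hg0
      rw [this]; unfold Int.fract; ring
    rw [Nat.cast_sub (by omega), Nat.cast_sub h1, max_eq_right (by linarith)]
    push_cast
    rw [h2]
    unfold psi
    constructor <;> ring
  · rw [not_le] at h
    have h1 : ⌊g⌋₊ < a := (Nat.floor_lt hg0).2 h
    rw [max_eq_left (by linarith), show ⌊g⌋₊ + 1 - a = 0 by omega, show ⌊g⌋₊ - a = 0 by omega]
    simp

lemma row (X : ℝ) (hX : 0 < X) (a : ℕ) (ha : 1 ≤ a) :
    |((∑ b ∈ range (a+1), (⌊(X + (b:ℝ)^2/4) / a⌋₊ + 1 - a) + ∑ b ∈ Ico 1 a, (⌊(X + (b:ℝ)^2/4) / a⌋₊ - a) : ℕ) : ℝ)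
      - 2 * (∫ u in (0:ℝ)..a, phi X a u) + 2 * ∑ b ∈ Fs X a, psi ((X + (b:ℝ)^2/4) / a)| ≤ 3 := by
  classical
  have htr := trap_err X a ha
  set D : ℕ → Prop := fun b => 4 * (a:ℝ)^2 ≤ 4 * X + (b:ℝ)^2 with hD
  set P : ℕ → ℝ := fun b => if D b then psi ((X + (b:ℝ)^2/4) / a) else 0 with hP
  set I : ℕ → ℝ := fun b => if D b then 1/2 else 0 with hI
  have hPb : ∀ b, |P b| ≤ 1/2 := by
    intro b; simp only [hP]; split_ifs
    · exact psi_abs _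
    · simp
  have hIb : ∀ b, 0 ≤ I b ∧ I b ≤ 1/2 := by
    intro b; simp only [hI]; split_ifs <;> norm_num
  have e1 : ∀ b : ℕ, ((⌊(X + (b:ℝ)^2/4) / a⌋₊ + 1 - a : ℕ) : ℝ) = phi X a b - P b + I b := by
    intro b; rw [(floor1 X hX a b ha).1]; simp only [hP, hI, hD]; split_ifs <;> ring
  have e2 : ∀ b : ℕ, ((⌊(X + (b:ℝ)^2/4) / a⌋₊ - a : ℕ) : ℝ) = phi X a b - P b - I b := by
    intro b; rw [(floor1 X hX a b ha).2]; simp only [hP, hI, hD]; split_ifs <;> ring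
  rw [Nat.cast_add, Nat.cast_sum, Nat.cast_sum]
  simp_rw [e1, e2]
  have e3 : ∑ b ∈ Fs X a, psi ((X + (b:ℝ)^2/4) / a) = ∑ b ∈ Ico 1 a, P b + P a := by
    unfold Fs
    rw [sum_filter]
    have : Icc 1 a = insert a (Ico 1 a) := by
      ext x; simp only [mem_Icc, mem_insert, mem_Ico]; omega
    rw [this, sum_insert (by simp), add_comm]
  have e4 : ∀ F : ℕ → ℝ, ∑ b ∈ range (a+1), F b = F 0 + ∑ b ∈ Ico 1 a, F b + F a := by
    intro F
    rw [sum_range_succ, range_eq_Ico, sum_eq_sum_Ico_succ_bot (by omega)]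
  have e5 : ∑ b ∈ range a, (phi X a b + phi X a ((b + 1 : ℕ) : ℝ)) / 2 = phi X a ((0:ℕ):ℝ) / 2 + ∑ b ∈ Ico 1 a, phi X a b + phi X a a / 2 := by
    have k1 : ∑ b ∈ range a, phi X a b = phi X a ((0:ℕ):ℝ) + ∑ b ∈ Ico 1 a, phi X a b := by
      rw [range_eq_Ico, sum_eq_sum_Ico_succ_bot (by omega)]
    have k2 : ∑ b ∈ range a, phi X a ((b + 1 : ℕ) : ℝ) = ∑ b ∈ Ico 1 a, phi X a b + phi X a a := by
      have := sum_range_succ' (fun b : ℕ => phi X a b) a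
      have h2 := e4 (fun b : ℕ => phi X a b)
      linarith
    rw [← sum_div, sum_add_distrib, k1, k2]; ring
  rw [e3, e4]
  simp only [sum_add_distrib, sum_sub_distrib]
  rw [e5] at htr
  have p0 := abs_le.1 (hPb 0)
  have pa := abs_le.1 (hPb a)
  have i0 := hIb 0
  have ia := hIb a
  rw [abs_le] at htr ⊢
  obtain ⟨t1, t2⟩ := htr
  obtain ⟨p01, p02⟩ := p0
  obtain ⟨pa1, pa2⟩ := pa
  obtain ⟨i01, i02⟩ := i0
  obtain ⟨ia1, ia2⟩ := ia
  clear hD hP hI hPb hIb e1 e2 e3 e4 e5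
  clear_value P I
  generalize ∑ x ∈ Ico 1 a, phi X a x = s1 at *
  generalize ∑ x ∈ Ico 1 a, P x = s2 at *
  generalize ∑ x ∈ Ico 1 a, I x = s3 at *
  generalize P 0 = P0 at *
  generalize I 0 = I0 at *
  generalize P a = Pa at *
  generalize I a = Ia at *
  generalize phi X a ((0:ℕ):ℝ) = q0 at *
  generalize phi X a a = qa at *
  generalize (∫ u in (0:ℝ)..a, phi X a u) = J at *
  constructor <;> linarith

/-- asymptotic count of class numbers. -/
theorem stmt_8 :
    ∃ C > (0:ℝ), ∃ X₀ : ℝ, ∀ X : ℝ, X₀ ≤ X →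
      |(Ncount X : ℝ) - (4*Real.pi/9) * X ^ ((3:ℝ)/2) + X| ≤ C * X ^ ((3:ℝ)/4) := by
  refine ⟨200000, by norm_num, 1, fun X hX1 => ?_⟩
  have hX : 0 < X := by linarith
  set Y := X ^ ((1:ℝ)/4) with hYdef
  have hY1 : 1 ≤ Y := Real.one_le_rpow hX1 (by norm_num)
  have hY4 : Y^4 = X := by
    rw [hYdef, ← Real.rpow_natCast, ← Real.rpow_mul hX.le]; norm_num
  have hY3 : X ^ ((3:ℝ)/4) = Y^3 := by
    rw [hYdef, ← Real.rpow_natCast, ← Real.rpow_mul hX.le]; norm_num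
  have hsq : √X = Y^2 := by
    rw [← hY4, show Y^4 = (Y^2)^2 by ring]; exact Real.sqrt_sq (by positivity)
  have hX32 : X ^ ((3:ℝ)/2) = X * √X := by
    rw [Real.sqrt_eq_rpow, ← Real.rpow_one_add' hX.le (by norm_num)]; norm_num
  rw [hY3, hX32]
  set L := ⌊2 * √X⌋₊ with hLdef
  have hL1 : 2 * √X < L + 1 := Nat.lt_floor_add_one _
  have hL2 : (L:ℝ) ≤ 2 * √X := Nat.floor_le (by positivity)
  have hmain := main_term X hX L hL1
  have hpsi := psi_total Y hY1 L (by
    rw [hsq] at hL2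
    have : (L:ℝ)^2 ≤ (2 * Y^2)^2 := by gcongr
    nlinarith)
  rw [hY4] at hpsi
  have hrows : |(Ncount X : ℝ) - 2 * (∑ a ∈ Ioc 0 L, ∫ u in (0:ℝ)..a, phi X a u) + 2 * ∑ a ∈ Ioc 0 L, ∑ b ∈ Fs X a, psi ((X + (b:ℝ)^2/4) / a)| ≤ 3 * L := by
    rw [count_eq X hX L hL1, Nat.cast_sum, mul_sum, mul_sum, ← sum_sub_distrib, ← sum_add_distrib]
    refine (abs_sum_le_sum_abs _ _).trans ((sum_le_sum fun a ha => row X hX a (mem_Ioc.1 ha).1).trans ?_)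
    rw [sum_const, Nat.card_Ioc, nsmul_eq_mul, Nat.sub_zero]; linarith
  have hY23 : Y^2 ≤ Y^3 := by nlinarith [sq_nonneg Y]
  have hLY : (L:ℝ) * Y ≤ 2 * Y^3 := by
    rw [hsq] at hL2
    nlinarith
  rw [hsq] at hL2 hmain ⊢
  rw [abs_le] at hmain hpsi hrows ⊢
  constructor <;> nlinarith
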